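/- arXiv:math/0311486 — 2 statements merged into one kernel-verified Lean document; each statement's English description precedes it below -/
import Mathlib

section
/- Generalized Thompson conjecture for SL(m,ℂ): Let m ≥ 1, n ≥ 3, and let α⁽¹⁾, …, α⁽ⁿ⁾ ∈ ℝᵐ be n vectors, each with decreasing entries α⁽ⁱ⁾₁ ≥ … ≥ α⁽ⁱ⁾ₘ and zero sum Σⱼ α⁽ⁱ⁾ⱼ = 0. Then the following are equivalent: (1) there exist traceless Hermitian m×m complex matrices A₁, …, Aₙ with A₁ + … + Aₙ = 0 such that, for each i, the multiset of eigenvalues of Aᵢ (with multiplicity) is {α⁽ⁱ⁾₁, …, α⁽ⁱ⁾ₘ}; (2) there exist matrices g₁, …, gₙ ∈ SL(m,ℂ) with g₁·g₂·…·gₙ = 1 such that, for each i, the multiset of eigenvalues of the positive-definite Hermitian matrix gᵢ·gᵢᴴ (with multiplicity) is {exp(2α⁽ⁱ⁾₁), …, exp(2α⁽ⁱ⁾ₘ)} (equivalently, the logarithms of the singular values of gᵢ are α⁽ⁱ⁾₁, …, α⁽ⁱ⁾ₘ). -/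
open Matrix

namespace Thompson

section Form

open scoped ComplexOrder

variable {ι κ : Type*} [Fintype ι] [Fintype κ]

/-- The real quadratic form `v ↦ re (vᴴ x v)` of a square complex matrix. -/
noncomputable def qf (x : Matrix ι ι ℂ) (v : ι → ℂ) : ℝ := (star v ⬝ᵥ x *ᵥ v).re

theorem qf_conj (x : Matrix ι ι ℂ) (T : Matrix ι κ ℂ) (v : κ → ℂ) :
    qf (Tᴴ * x * T) v = qf x (T *ᵥ v) := by
  simp only [qf, ← mulVec_mulVec, star_mulVec, dotProduct_mulVec, vecMul_vecMul, Matrix.mul_assoc]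

theorem qf_add (x y : Matrix ι ι ℂ) (v : ι → ℂ) : qf (x + y) v = qf x v + qf y v := by
  simp [qf, add_mulVec]

theorem qf_sub (x y : Matrix ι ι ℂ) (v : ι → ℂ) : qf (x - y) v = qf x v - qf y v := by
  simp [qf, sub_mulVec]

theorem qf_smul (c : ℝ) (x : Matrix ι ι ℂ) (v : ι → ℂ) : qf (c • x) v = c * qf x v := by
  simp [qf, smul_mulVec]

theorem qf_diagonal [DecidableEq ι] (d : ι → ℝ) (v : ι → ℂ) :
    qf (diagonal fun j => (d j : ℂ)) v = ∑ j, d j * ‖v j‖ ^ 2 := by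
  simp only [qf, dotProduct, mulVec_diagonal, Complex.re_sum]
  refine Finset.sum_congr rfl fun j _ => ?_
  rw [← Complex.normSq_eq_norm_sq, Complex.normSq_apply]
  simp
  ring

theorem qf_one [DecidableEq ι] (v : ι → ℂ) :
    qf (1 : Matrix ι ι ℂ) v = ∑ j, ‖v j‖ ^ 2 := by
  simpa using qf_diagonal (fun _ : ι => (1 : ℝ)) v

theorem qf_conjTranspose_mul_self (T : Matrix κ ι ℂ) (v : ι → ℂ) :
    qf (Tᴴ * T) v = ∑ j, ‖(T *ᵥ v) j‖ ^ 2 := by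
  classical
  rw [← qf_one, ← qf_conj, Matrix.mul_one]

theorem qf_nonneg {x : Matrix ι ι ℂ} (hx : x.PosSemidef) (v : ι → ℂ) : 0 ≤ qf x v :=
  hx.re_dotProduct_nonneg v

theorem qf_pos {x : Matrix ι ι ℂ} (hx : x.PosDef) {v : ι → ℂ} (hv : v ≠ 0) : 0 < qf x v :=
  hx.re_dotProduct_pos hv

theorem ofReal_qf {x : Matrix ι ι ℂ} (hx : x.IsHermitian) (v : ι → ℂ) :
    ((qf x v : ℝ) : ℂ) = star v ⬝ᵥ x *ᵥ v :=
  Complex.ext rfl (by simpa using (hx.im_star_dotProduct_mulVec_self v).symm)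

theorem posSemidef_of_qf {x : Matrix ι ι ℂ} (hx : x.IsHermitian) (h : ∀ v, 0 ≤ qf x v) :
    x.PosSemidef :=
  .of_dotProduct_mulVec_nonneg hx fun v => by
    rw [← ofReal_qf hx]; exact_mod_cast h v

theorem posDef_of_qf {x : Matrix ι ι ℂ} (hx : x.IsHermitian) (h : ∀ v, v ≠ 0 → 0 < qf x v) :
    x.PosDef :=
  .of_dotProduct_mulVec_pos hx fun v hv => by
    rw [← ofReal_qf hx]; exact_mod_cast h v hv

theorem exists_eq_conjTranspose_mul_self {x : Matrix ι ι ℂ} (hx : x.PosSemidef) :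
    ∃ T : Matrix ι ι ℂ, x = Tᴴ * T := by
  classical
  open scoped MatrixOrder Matrix.Norms.L2Operator in
  exact (CStarAlgebra.nonneg_iff_eq_star_mul_self).1 hx.nonneg

theorem abs_qf_le (h : Matrix ι ι ℂ) (v : ι → ℂ) :
    |qf h v| ≤ (∑ i, ∑ j, ‖h i j‖) * ∑ j, ‖v j‖ ^ 2 := by
  have hle : ∀ i, ‖v i‖ ^ 2 ≤ ∑ j, ‖v j‖ ^ 2 := fun i =>
    Finset.single_le_sum (f := fun j => ‖v j‖ ^ 2) (fun j _ => sq_nonneg _) (Finset.mem_univ i)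
  calc |qf h v| ≤ ‖star v ⬝ᵥ h *ᵥ v‖ := Complex.abs_re_le_norm _
    _ ≤ ∑ i, ∑ j, ‖h i j‖ * ∑ j, ‖v j‖ ^ 2 := by
      refine (norm_sum_le _ _).trans (Finset.sum_le_sum fun i _ => ?_)
      rw [norm_mul, mulVec, dotProduct]
      refine (mul_le_mul_of_nonneg_left (norm_sum_le _ _) (norm_nonneg _)).trans ?_
      rw [Finset.mul_sum]
      refine Finset.sum_le_sum fun j _ => ?_
      rw [norm_mul, Pi.star_apply, norm_star]
      have := mul_le_mul_of_nonneg_left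
        (show ‖v i‖ * ‖v j‖ ≤ ∑ j, ‖v j‖ ^ 2 by nlinarith [hle i, hle j, sq_nonneg (‖v i‖ - ‖v j‖)])
        (norm_nonneg (h i j))
      linarith
    _ = _ := by simp only [Finset.sum_mul]

open Filter Topology in
theorem eventually_abs_qf_sub_le {x : ℕ → Matrix ι ι ℂ} {y : Matrix ι ι ℂ}
    (h : Tendsto x atTop (𝓝 y)) {η : ℝ} (hη : 0 < η) :
    ∀ᶠ k in atTop, ∀ v, |qf (x k) v - qf y v| ≤ η * ∑ j, ‖v j‖ ^ 2 := by
  have hc : Tendsto (fun k => ∑ i, ∑ j, ‖(x k - y) i j‖) atTop (𝓝 0) := by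
    have : Continuous fun z : Matrix ι ι ℂ => ∑ i, ∑ j, ‖(z - y) i j‖ := by
      simp only [Matrix.sub_apply]
      fun_prop
    simpa [Function.comp_def] using (this.tendsto y).comp h
  filter_upwards [hc.eventually (gt_mem_nhds hη)] with k hk v
  rw [← qf_sub]
  exact (abs_qf_le _ v).trans
    (mul_le_mul_of_nonneg_right hk.le (Finset.sum_nonneg fun _ _ => sq_nonneg _))

theorem continuous_qf (v : ι → ℂ) : Continuous fun x : Matrix ι ι ℂ => qf x v := by
  unfold qf
  fun_prop

theorem exists_sum_le_mul_qf [DecidableEq ι] {x : Matrix ι ι ℂ} (hx : x.PosDef) :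
    ∃ c : ℝ, 0 < c ∧ ∀ v, ∑ j, ‖v j‖ ^ 2 ≤ c * qf x v := by
  obtain ⟨S, rfl⟩ := exists_eq_conjTranspose_mul_self hx.posSemidef
  have hS : IsUnit S.det := by
    have := (Matrix.isUnit_iff_isUnit_det _).1 hx.isUnit
    rw [det_mul] at this
    exact isUnit_of_mul_isUnit_right this
  set C := ∑ i, ∑ j, ‖((S⁻¹)ᴴ * S⁻¹) i j‖
  have hC : 0 ≤ C := by positivity
  refine ⟨C + 1, by positivity, fun v => ?_⟩
  have h1 := le_of_abs_le (abs_qf_le ((S⁻¹)ᴴ * S⁻¹) (S *ᵥ v))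
  rw [qf_conjTranspose_mul_self, mulVec_mulVec, Matrix.nonsing_inv_mul _ hS, one_mulVec,
    ← qf_conjTranspose_mul_self S v] at h1
  have h2 := qf_nonneg (posSemidef_conjTranspose_mul_self S) v
  change _ ≤ C * _ at h1
  linarith

instance : FirstCountableTopology (Matrix ι κ ℂ) :=
  inferInstanceAs (FirstCountableTopology (ι → κ → ℂ))

theorem isCompact_setOf_trace_conjTranspose_mul_self_le (c : ℝ) :
    IsCompact {A : Matrix ι ι ℂ | (Aᴴ * A).trace.re ≤ c} := by
  have hcpt : IsCompact {A : Matrix ι ι ℂ | ∀ i j, A i j ∈ Metric.closedBall 0 (√c)} := by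
    have := isCompact_univ_pi fun _ : ι => isCompact_univ_pi fun _ : ι =>
      isCompact_closedBall (0 : ℂ) (√c)
    have heq : {A : Matrix ι ι ℂ | ∀ i j, A i j ∈ Metric.closedBall 0 (√c)} =
        Set.univ.pi fun _ : ι => Set.univ.pi fun _ : ι => Metric.closedBall (0 : ℂ) (√c) :=
      Set.ext fun A => ⟨fun h i _ j _ => h i j, fun h i j => h i trivial j trivial⟩
    exact heq ▸ this
  refine hcpt.of_isClosed_subset ?_ fun T hT i j => ?_
  · have : Continuous fun A : Matrix ι ι ℂ => (Aᴴ * A).trace.re := by fun_prop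
    exact isClosed_le this continuous_const
  · rw [mem_closedBall_zero_iff]
    apply Real.le_sqrt_of_sq_le
    have h1 : (Tᴴ * T).trace.re = ∑ j, ∑ i, ‖T i j‖ ^ 2 := by
      rw [Matrix.trace, Complex.re_sum]
      refine Finset.sum_congr rfl fun j _ => ?_
      simp only [diag_apply, mul_apply, conjTranspose_apply, Complex.re_sum]
      refine Finset.sum_congr rfl fun i _ => ?_
      rw [← Complex.normSq_eq_norm_sq, Complex.normSq_apply]
      simp
    refine le_trans ?_ (h1.symm.le.trans hT)
    refine le_trans ?_ (Finset.single_le_sum (f := fun j => ∑ i, ‖T i j‖ ^ 2)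
      (fun j _ => by positivity) (Finset.mem_univ j))
    exact Finset.single_le_sum (f := fun i => ‖T i j‖ ^ 2)
      (fun j _ => by positivity) (Finset.mem_univ i)

open Filter Topology in
/-- Matrices of bounded Hilbert-Schmidt norm are sequentially compact. -/
theorem exists_tendsto_of_trace_conjTranspose_mul_self_le {T : ℕ → Matrix ι ι ℂ} {c : ℝ}
    (hc : ∀ k, ((T k)ᴴ * T k).trace.re ≤ c) :
    ∃ S : Matrix ι ι ℂ, ∃ φ : ℕ → ℕ, StrictMono φ ∧ Tendsto (T ∘ φ) atTop (𝓝 S) := by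
  obtain ⟨S, -, h⟩ := (isCompact_setOf_trace_conjTranspose_mul_self_le c).tendsto_subseq hc
  exact ⟨S, h⟩

open Filter Topology in
/-- Simultaneous extraction of a convergent subsequence from countably many bounded sequences. -/
theorem exists_tendsto_family {T : ℕ → ℕ → Matrix ι ι ℂ} {c : ℕ → ℝ}
    (hc : ∀ k i, ((T k i)ᴴ * T k i).trace.re ≤ c i) :
    ∃ S : ℕ → Matrix ι ι ℂ, ∃ φ : ℕ → ℕ, StrictMono φ ∧
      ∀ i, Tendsto (fun k => T (φ k) i) atTop (𝓝 (S i)) := by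
  obtain ⟨S, -, φ, hφ, h⟩ := (isCompact_univ_pi fun i =>
    isCompact_setOf_trace_conjTranspose_mul_self_le (ι := ι) (c i)).tendsto_subseq
      (x := T) fun k i _ => hc k i
  exact ⟨S, φ, hφ, tendsto_pi_nhds.1 h⟩

open Filter Topology in
/-- Positive semidefinite matrices of bounded trace are sequentially compact. -/
theorem exists_tendsto_of_trace_le {x : ℕ → Matrix ι ι ℂ} (hx : ∀ k, (x k).PosSemidef) {c : ℝ}
    (hc : ∀ k, (x k).trace.re ≤ c) :
    ∃ y : Matrix ι ι ℂ, y.PosSemidef ∧ ∃ φ : ℕ → ℕ, StrictMono φ ∧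
      Tendsto (x ∘ φ) atTop (𝓝 y) := by
  choose T hT using fun k => exists_eq_conjTranspose_mul_self (hx k)
  obtain ⟨S, φ, hφ, hS⟩ :=
    exists_tendsto_of_trace_conjTranspose_mul_self_le (T := T) fun k => hT k ▸ hc k
  refine ⟨Sᴴ * S, posSemidef_conjTranspose_mul_self S, φ, hφ, ?_⟩
  have : Continuous fun A : Matrix ι ι ℂ => Aᴴ * A := by fun_prop
  have h2 := (this.tendsto S).comp hS
  refine h2.congr fun k => ?_
  simp [hT]

end Form

section Perron

open scoped ComplexOrder
open Filter Topology

variable {ι : Type*} [Fintype ι] [DecidableEq ι]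

/-- A nonlinear Perron–Frobenius alternative: a monotone homogeneous self-map of the cone of
positive definite matrices either has approximate `s`-supersolutions, or has an `s`-subsolution
on the closed cone. -/
theorem exists_supersolution_or_subsolution (Φ : Matrix ι ι ℂ → Matrix ι ι ℂ)
    (hpd : ∀ x, x.PosDef → (Φ x).PosDef)
    (hmono : ∀ x y, x.PosDef → y.PosDef → ∀ c : ℝ, 0 < c → (∀ v, qf x v ≤ c * qf y v) →
      ∀ v, qf (Φ x) v ≤ c * qf (Φ y) v) {s : ℝ} (hs : 0 < s) :
    (∀ s', s < s' → ∃ x, x.PosDef ∧ ∀ v, qf (Φ x) v ≤ s' * qf x v) ∨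
      ∃ x, x.PosSemidef ∧ x ≠ 0 ∧
        ∀ δ : ℝ, 0 < δ → ∀ v, s * qf x v ≤ qf (Φ (x + δ • 1)) v := by
  obtain ⟨u, hu0, hu⟩ : ∃ u : ℕ → Matrix ι ι ℂ,
      u 0 = s⁻¹ • 1 ∧ ∀ k, u (k + 1) = s⁻¹ • (Φ (u k) + 1) :=
    ⟨fun k => Nat.rec (s⁻¹ • 1) (fun _ x => s⁻¹ • (Φ x + 1)) k, rfl, fun _ => rfl⟩
  have hupd : ∀ k, (u k).PosDef := by
    intro k
    induction k with
    | zero => exact hu0 ▸ PosDef.one.smul (inv_pos.2 hs)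
    | succ k ih => exact hu k ▸ ((hpd _ ih).add PosDef.one).smul (inv_pos.2 hs)
  have husucc : ∀ k v, s * qf (u (k + 1)) v = qf (Φ (u k)) v + ∑ j, ‖v j‖ ^ 2 := by
    intro k v
    rw [hu, qf_smul, qf_add, qf_one, mul_inv_cancel_left₀ hs.ne']
  have hle : ∀ k v, qf (u k) v ≤ qf (u (k + 1)) v := by
    intro k
    induction k with
    | zero =>
      intro v
      refine le_of_mul_le_mul_left ?_ hs
      rw [husucc]
      have : s * qf (u 0) v = ∑ j, ‖v j‖ ^ 2 := by
        rw [hu0, qf_smul, qf_one, mul_inv_cancel_left₀ hs.ne']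
      linarith [qf_nonneg (hpd _ (hupd 0)).posSemidef v]
    | succ k ih =>
      intro v
      refine le_of_mul_le_mul_left ?_ hs
      rw [husucc k, husucc (k + 1)]
      have := hmono _ _ (hupd k) (hupd (k + 1)) 1 one_pos (by simpa using ih) v
      linarith
  have humono : ∀ v, Monotone fun k => qf (u k) v := fun v => monotone_nat_of_le_succ (hle · v)
  by_cases hb : ∃ c, ∀ k, (u k).trace.re ≤ c
  · left
    obtain ⟨c, hc⟩ := hb
    obtain ⟨y, hy, φ, hφ, hlim⟩ := exists_tendsto_of_trace_le (fun k => (hupd k).posSemidef) hc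
    have huy : ∀ k v, qf (u k) v ≤ qf y v := by
      intro k v
      refine ge_of_tendsto (((continuous_qf v).tendsto y).comp hlim) ?_
      filter_upwards [eventually_ge_atTop k] with n hn
      exact humono v (hn.trans (hφ.id_le n))
    have hypd : y.PosDef := posDef_of_qf hy.1 fun v hv => (qf_pos (hupd 0) hv).trans_le (huy 0 v)
    obtain ⟨C, hC, hCu⟩ := exists_sum_le_mul_qf (hupd 0)
    intro s' hs'
    refine ⟨y, hypd, ?_⟩
    obtain ⟨k, hk⟩ := (eventually_abs_qf_sub_le hlim
      (show 0 < (s' / s - 1) / C from div_pos (by rwa [sub_pos, one_lt_div hs]) hC)).exists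
    have h1 : ∀ v, qf y v ≤ (s' / s) * qf (u (φ k)) v := by
      intro v
      have h2 := (abs_le.1 (hk v)).1
      have h3 : ∑ j, ‖v j‖ ^ 2 ≤ C * qf (u (φ k)) v :=
        (hCu v).trans (mul_le_mul_of_nonneg_left (humono v (Nat.zero_le _)) hC.le)
      have h4 := mul_le_mul_of_nonneg_left h3
        (show 0 ≤ (s' / s - 1) / C from (div_pos (by rwa [sub_pos, one_lt_div hs]) hC).le)
      rw [← mul_assoc, div_mul_cancel₀ _ hC.ne'] at h4
      simp only [Function.comp_apply] at h2
      linarith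
    intro v
    have hs0 : 0 < s' / s := div_pos (hs.trans hs') hs
    refine (hmono _ _ hypd (hupd _) _ hs0 h1 v).trans ?_
    have h5 := husucc (φ k) v
    have h6 := huy (φ k + 1) v
    have h7 : 0 ≤ ∑ j, ‖v j‖ ^ 2 := by positivity
    calc s' / s * qf (Φ (u (φ k))) v ≤ s' / s * (s * qf y v) := 
        mul_le_mul_of_nonneg_left (by linarith [mul_le_mul_of_nonneg_left h6 hs.le]) hs0.le
      _ = s' * qf y v := by field_simp
  · right
    push Not at hb
    choose k hk using fun n : ℕ => hb (n + 1)
    set t : ℕ → ℝ := fun n => (u (k n)).trace.re with ht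
    have htn : ∀ n : ℕ, (n : ℝ) + 1 < t n := hk
    have ht0 : ∀ n, 0 < t n := fun n => lt_trans (by positivity) (htn n)
    obtain ⟨x, hx, φ, hφ, hlim⟩ := exists_tendsto_of_trace_le
      (x := fun n => (t n)⁻¹ • u (k n)) (c := 1)
      (fun n => ((hupd _).smul (inv_pos.2 (ht0 n))).posSemidef) (fun n => by
        rw [trace_smul, Complex.smul_re, smul_eq_mul, inv_mul_cancel₀ (ht0 n).ne'])
    refine ⟨x, hx, ?_, fun δ hδ v => ?_⟩
    · rintro rfl
      have hcont : Continuous fun z : Matrix ι ι ℂ => z.trace.re := by fun_prop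
      have h1 := (hcont.tendsto 0).comp hlim
      have h2 : (fun z : Matrix ι ι ℂ => z.trace.re) ∘ (fun n => (t n)⁻¹ • u (k n)) ∘ φ =
          fun _ => 1 := by
        ext n
        simp only [Function.comp_apply]
        rw [trace_smul, Complex.smul_re, smul_eq_mul, inv_mul_cancel₀ (ht0 _).ne']
      rw [h2] at h1
      have := tendsto_nhds_unique h1 tendsto_const_nhds
      simp at this
    · have hxδ : (x + δ • 1).PosDef := PosDef.posSemidef_add hx (PosDef.one.smul hδ)
      have key : ∀ᶠ n in atTop, s * qf ((t (φ n))⁻¹ • u (k (φ n))) v ≤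
          qf (Φ (x + δ • 1)) v + (∑ j, ‖v j‖ ^ 2) * (t (φ n))⁻¹ := by
        filter_upwards [eventually_abs_qf_sub_le hlim hδ] with n hn
        have h1 : ∀ w, qf (u (k (φ n))) w ≤ t (φ n) * qf (x + δ • 1) w := by
          intro w
          have h2 := (abs_le.1 (hn w)).2
          simp only [Function.comp_apply, qf_smul] at h2
          rw [qf_add, qf_smul, qf_one, ← div_le_iff₀' (ht0 _), div_eq_inv_mul]
          linarith
        have h2 := hmono _ _ (hupd _) hxδ _ (ht0 _) h1 v
        have h3 := husucc (k (φ n)) v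
        have h4 := mul_le_mul_of_nonneg_left (hle (k (φ n)) v) hs.le
        rw [qf_smul]
        have h5 := mul_le_mul_of_nonneg_left
          (show s * qf (u (k (φ n))) v ≤ t (φ n) * qf (Φ (x + δ • 1)) v + ∑ j, ‖v j‖ ^ 2 by
            linarith) (inv_pos.2 (ht0 (φ n))).le
        rw [mul_add, inv_mul_cancel_left₀ (ht0 _).ne'] at h5
        linarith
      have hinv : Tendsto (fun n => (t (φ n))⁻¹) atTop (𝓝 0) := by
        refine Tendsto.inv_tendsto_atTop (tendsto_atTop_mono (fun n => ?_)
          tendsto_natCast_atTop_atTop)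
        have h1 : (n : ℝ) ≤ φ n := by exact_mod_cast hφ.id_le n
        linarith [htn (φ n)]
      refine le_of_tendsto_of_tendsto ((((continuous_qf v).tendsto x).comp hlim).const_mul s) ?_ key
      simpa using (hinv.const_mul (∑ j, ‖v j‖ ^ 2)).const_add (qf (Φ (x + δ • 1)) v)

end Perron

section Flag

open scoped ComplexOrder
open Filter Topology Module

/-- Abel summation against a monotone weight: nonnegative tail sums give a nonnegative pairing. -/
theorem sum_mul_nonneg_of_tail {m : ℕ} {γ d : Fin m → ℝ} (hγ : Monotone γ)
    (htail : ∀ k : ℕ, k ≤ m → 0 ≤ ∑ j : Fin m, if k ≤ (j : ℕ) then d j else 0)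
    (h : (∀ j, 0 ≤ γ j) ∨ ∑ j, d j = 0) : 0 ≤ ∑ j, γ j * d j := by
  have key : ∀ (n : ℕ) (γ d : Fin (n + 1) → ℝ), Monotone γ →
      (∀ k : ℕ, k ≤ n + 1 → 0 ≤ ∑ j : Fin (n + 1), if k ≤ (j : ℕ) then d j else 0) →
      γ 0 * ∑ j, d j ≤ ∑ j, γ j * d j := by
    intro n
    induction n with
    | zero => intro γ d _ _; simp
    | succ n ih =>
      intro γ d hγ hd
      rw [Fin.sum_univ_succ, Fin.sum_univ_succ (fun j => γ j * d j)]
      have h1 := ih (fun j => γ j.succ) (fun j => d j.succ)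
        (fun a b hab => hγ (Fin.succ_le_succ_iff.2 hab)) (fun k hk => by
          have := hd (k + 1) (by omega)
          rw [Fin.sum_univ_succ] at this
          simpa using this)
      have h2 : 0 ≤ ∑ j : Fin (n + 1), d j.succ := by
        have := hd 1 (by omega)
        rw [Fin.sum_univ_succ] at this
        simpa using this
      have h3 : γ 0 ≤ γ (Fin.succ 0) := hγ (Fin.zero_le _)
      have h4 := mul_le_mul_of_nonneg_right h3 h2
      linarith
  cases m with
  | zero => simp
  | succ n =>
    refine le_trans ?_ (key n γ d hγ htail)
    rcases h with h | h
    · exact mul_nonneg (h 0) (by simpa using htail 0 (Nat.zero_le _))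
    · rw [h, mul_zero]

/-- The subspace of the standard flag spanned by the first `k` basis vectors. -/
def coordSub (m k : ℕ) : Submodule ℂ (Fin m → ℂ) where
  carrier := {v | ∀ i : Fin m, k ≤ (i : ℕ) → v i = 0}
  add_mem' ha hb i hi := by simp [ha i hi, hb i hi]
  zero_mem' := by simp
  smul_mem' c v hv i hi := by simp [hv i hi]

variable {m : ℕ}

theorem coordSub_self : coordSub m m = ⊤ :=
  eq_top_iff.2 fun _ _ i hi => absurd i.2 (not_lt.2 hi)

theorem coordSub_zero : coordSub m 0 = ⊥ :=
  eq_bot_iff.2 fun _ hv => funext fun i => hv i (Nat.zero_le _)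

/-- The jumps of the dimension of the intersections of `K` with the standard flag. -/
noncomputable def jump (K : Submodule ℂ (Fin m → ℂ)) (j : Fin m) : ℝ :=
  finrank ℂ ↥(K ⊓ coordSub m (j + 1)) - finrank ℂ ↥(K ⊓ coordSub m j)

theorem sum_jump_tail (K : Submodule ℂ (Fin m → ℂ)) {k : ℕ} (hk : k ≤ m) :
    (∑ j : Fin m, if k ≤ (j : ℕ) then jump K j else 0) =
      finrank ℂ K - finrank ℂ ↥(K ⊓ coordSub m k) := by
  have key : ∀ (f : ℕ → ℝ) (n : ℕ), k ≤ n →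
      (∑ j ∈ Finset.range n, if k ≤ j then f (j + 1) - f j else 0) = f n - f k := by
    intro f n hn
    induction n, hn using Nat.le_induction with
    | base =>
      rw [sub_self]
      exact Finset.sum_eq_zero fun j hj => if_neg (not_le.2 (Finset.mem_range.1 hj))
    | succ n hn ih =>
      rw [Finset.sum_range_succ, ih, if_pos hn]
      ring
  have h := key (fun j => (finrank ℂ ↥(K ⊓ coordSub m j) : ℝ)) m hk
  rw [← Fin.sum_univ_eq_sum_range
    (fun j => if k ≤ j then (finrank ℂ ↥(K ⊓ coordSub m (j + 1)) : ℝ) -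
      finrank ℂ ↥(K ⊓ coordSub m j) else 0)] at h
  have hm : finrank ℂ ↥(K ⊓ coordSub m m) = finrank ℂ K := by rw [coordSub_self, inf_top_eq]
  rw [← hm]
  exact h

theorem sum_jump (K : Submodule ℂ (Fin m → ℂ)) : ∑ j, jump K j = finrank ℂ K := by
  have h := sum_jump_tail K (Nat.zero_le m)
  rw [coordSub_zero, inf_bot_eq, finrank_bot] at h
  simpa using h

theorem jump_map_diagonal (K : Submodule ℂ (Fin m → ℂ)) {d : Fin m → ℂ} (hd : ∀ j, d j ≠ 0) :
    jump (K.map (diagonal d).mulVecLin) = jump K := by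
  have hinj : Function.Injective (diagonal d).mulVecLin := by
    intro v w hvw
    funext j
    have := congrFun hvw j
    simpa [mulVec_diagonal, hd j] using this
  have key : ∀ k, finrank ℂ ↥(K.map (diagonal d).mulVecLin ⊓ coordSub m k) =
      finrank ℂ ↥(K ⊓ coordSub m k) := by
    intro k
    have h1 : K.map (diagonal d).mulVecLin ⊓ coordSub m k =
        (K ⊓ coordSub m k).map (diagonal d).mulVecLin := by
      ext w
      simp only [Submodule.mem_inf, Submodule.mem_map]
      constructor
      · rintro ⟨⟨v, hv, rfl⟩, hw⟩
        refine ⟨v, ⟨hv, fun i hi => ?_⟩, rfl⟩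
        have := hw i hi
        simpa [mulVec_diagonal, hd i] using this
      · rintro ⟨v, ⟨hv, hvk⟩, rfl⟩
        refine ⟨⟨v, hv, rfl⟩, fun i hi => ?_⟩
        simp [mulVec_diagonal, hvk i hi]
    rw [h1]
    exact (Submodule.equivMapOfInjective _ hinj _).finrank_eq.symm
  funext j
  simp only [jump, key]

theorem exists_isometry (K : Submodule ℂ (Fin m → ℂ)) :
    ∃ C : Matrix (Fin m) (Fin (finrank ℂ K)) ℂ, Cᴴ * C = 1 ∧
      LinearMap.range C.mulVecLin = K := by
  let e := (WithLp.linearEquiv 2 ℂ (Fin m → ℂ)).symm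
  let K' : Submodule ℂ (EuclideanSpace ℂ (Fin m)) := K.map e.toLinearMap
  have hK' : finrank ℂ K' = finrank ℂ K := LinearEquiv.finrank_map_eq e K
  let b := (stdOrthonormalBasis ℂ K').reindex (finCongr hK')
  refine ⟨Matrix.of fun i j => (b j : EuclideanSpace ℂ (Fin m)) i, ?_, ?_⟩
  · ext i j
    have h := orthonormal_iff_ite.1 b.orthonormal i j
    rw [Submodule.coe_inner, EuclideanSpace.inner_eq_star_dotProduct] at h
    rw [mul_apply, one_apply, ← h, dotProduct_comm]
    rfl
  · have hspan := b.toBasis.span_eq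
    have h1 : LinearMap.range (Matrix.of fun i j => (b j : EuclideanSpace ℂ (Fin m)) i).mulVecLin =
        Submodule.span ℂ (Set.range fun j => e.symm (b j : EuclideanSpace ℂ (Fin m))) := by
      rw [Matrix.range_mulVecLin]
      rfl
    have h2 := congrArg (fun S => (S.map K'.subtype).map e.symm.toLinearMap) hspan
    simp only [Submodule.map_span, Submodule.map_top, Submodule.range_subtype] at h2
    have h3 : K'.map e.symm.toLinearMap = K := by
      rw [← Submodule.map_comp]
      simp
    refine h1.trans (Eq.trans ?_ (h2.trans h3))
    rw [← Set.range_comp, ← Set.range_comp]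
    congr 1

end Flag

section Projection

open scoped ComplexOrder
open Filter Topology Module

variable {m : ℕ}

theorem mul_eq_of_forall_mem_range {κ : Type*} [Fintype κ] [DecidableEq κ]
    {A : Matrix (Fin m) (Fin m) ℂ} {C : Matrix (Fin m) κ ℂ}
    (h : ∀ v ∈ LinearMap.range C.mulVecLin, A *ᵥ v = v) : A * C = C := by
  refine ext_of_mulVec_single fun i => ?_
  rw [← mulVec_mulVec]
  exact h _ ⟨_, rfl⟩

theorem mulVec_of_mem_range {P : Matrix (Fin m) (Fin m) ℂ} (h : P * P = P) {v : Fin m → ℂ}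
    (hv : v ∈ LinearMap.range P.mulVecLin) : P *ᵥ v = v := by
  obtain ⟨w, rfl⟩ := hv
  rw [mulVecLin_apply, mulVec_mulVec, h]

theorem mul_conjTranspose_mulVec {κ : Type*} [Fintype κ] [DecidableEq κ]
    {C : Matrix (Fin m) κ ℂ} (h : Cᴴ * C = 1) {v : Fin m → ℂ}
    (hv : v ∈ LinearMap.range C.mulVecLin) : (C * Cᴴ) *ᵥ v = v := by
  obtain ⟨w, rfl⟩ := hv
  rw [mulVecLin_apply, mulVec_mulVec, Matrix.mul_assoc, h, Matrix.mul_one]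

theorem eq_mul_conjTranspose {κ : Type*} [Fintype κ] [DecidableEq κ]
    {P : Matrix (Fin m) (Fin m) ℂ} {C : Matrix (Fin m) κ ℂ} (hP : P.IsHermitian) (h : P * P = P)
    (hC : Cᴴ * C = 1) (hr : LinearMap.range C.mulVecLin = LinearMap.range P.mulVecLin) :
    P = C * Cᴴ := by
  have h1 : P * C = C := mul_eq_of_forall_mem_range fun v hv => mulVec_of_mem_range h (hr ▸ hv)
  have h2 : (C * Cᴴ) * P = P := mul_eq_of_forall_mem_range fun v hv =>
    mul_conjTranspose_mulVec hC (hr ▸ hv)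
  have h3 := congrArg conjTranspose h2
  rw [conjTranspose_mul, conjTranspose_mul, conjTranspose_conjTranspose, hP.eq, ← Matrix.mul_assoc,
    h1] at h3
  exact h3.symm

theorem trace_mul_conjTranspose_isometry {κ : Type*} [Fintype κ] [DecidableEq κ]
    {C : Matrix (Fin m) κ ℂ} (hC : Cᴴ * C = 1) : (C * Cᴴ).trace = Fintype.card κ := by
  rw [trace_mul_comm, hC, trace_one]

/-- The trace of a compressed monotone diagonal matrix is dominated by the pairing with the
jumps of the range of the projection. -/
theorem sum_mul_re_diag_le {P : Matrix (Fin m) (Fin m) ℂ} (hP : P.IsHermitian) (h : P * P = P)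
    {β : Fin m → ℝ} (hβ : Monotone β) :
    ∑ j, β j * (P j j).re ≤ ∑ j, β j * jump (LinearMap.range P.mulVecLin) j := by
  set K := LinearMap.range P.mulVecLin with hK
  have htr : ∑ j, (P j j).re = finrank ℂ K := by
    obtain ⟨C, hC, hr⟩ := exists_isometry K
    have h1 := congrArg trace (eq_mul_conjTranspose hP h hC hr)
    rw [trace_mul_conjTranspose_isometry hC, Fintype.card_fin] at h1
    have := congrArg Complex.re h1
    simpa [trace] using this
  suffices 0 ≤ ∑ j, β j * (jump K j - (P j j).re) by
    simp only [mul_sub, Finset.sum_sub_distrib] at this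
    linarith
  refine sum_mul_nonneg_of_tail hβ (fun k hk => ?_) (.inr ?_)
  · obtain ⟨C, hC, hr⟩ := exists_isometry (K ⊓ coordSub m k)
    set D : Matrix (Fin m) (Fin m) ℂ := diagonal fun j => if (j : ℕ) < k then 1 else 0 with hD
    have hPC : P * C = C := mul_eq_of_forall_mem_range fun v hv =>
      mulVec_of_mem_range h (hr ▸ hv : v ∈ K ⊓ coordSub m k).1
    have hDC : D * C = C := mul_eq_of_forall_mem_range fun v hv => by
      have hv' := (hr ▸ hv : v ∈ K ⊓ coordSub m k).2
      funext j
      rw [hD, mulVec_diagonal]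
      by_cases hj : (j : ℕ) < k
      · simp [hj]
      · simp [hj, hv' j (not_lt.1 hj)]
    have hDH : Dᴴ = D := by
      rw [hD, diagonal_conjTranspose]
      congr 1
      funext j
      simp only [Pi.star_apply]
      split_ifs <;> simp
    have hDD : D * D = D := by
      rw [hD, diagonal_mul_diagonal]
      congr 1
      funext j
      split_ifs <;> simp
    have hCP : Cᴴ * P = Cᴴ := by simpa [hP.eq] using congrArg conjTranspose hPC
    have hCD : Cᴴ * D = Cᴴ := by simpa [hDH] using congrArg conjTranspose hDC
    have hX : (D * P - C * Cᴴ)ᴴ * (D * P - C * Cᴴ) = P * D * P - C * Cᴴ := by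
      rw [conjTranspose_sub, conjTranspose_mul, conjTranspose_mul, conjTranspose_conjTranspose,
        hDH, hP.eq, Matrix.sub_mul, Matrix.mul_sub, Matrix.mul_sub]
      have e1 : P * D * (D * P) = P * D * P := by
        rw [Matrix.mul_assoc, ← Matrix.mul_assoc D, hDD, Matrix.mul_assoc]
      have e2 : P * D * (C * Cᴴ) = C * Cᴴ := by
        rw [Matrix.mul_assoc, ← Matrix.mul_assoc D, hDC, ← Matrix.mul_assoc, hPC]
      have e3 : C * Cᴴ * (D * P) = C * Cᴴ := by
        rw [Matrix.mul_assoc, ← Matrix.mul_assoc Cᴴ, hCD, hCP]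
      have e4 : C * Cᴴ * (C * Cᴴ) = C * Cᴴ := by
        rw [Matrix.mul_assoc, ← Matrix.mul_assoc Cᴴ, hC, Matrix.one_mul]
      rw [e1, e2, e3, e4]
      abel
    have hpos := (posSemidef_conjTranspose_mul_self (D * P - C * Cᴴ)).trace_nonneg
    have hDP : (P * D * P).trace = ∑ j : Fin m, if (j : ℕ) < k then P j j else 0 := by
      rw [trace_mul_comm, ← Matrix.mul_assoc, h, trace]
      refine Finset.sum_congr rfl fun j _ => ?_
      rw [diag_apply, hD, mul_diagonal]
      split_ifs <;> simp
    rw [hX, trace_sub, hDP, trace_mul_conjTranspose_isometry hC, Fintype.card_fin] at hpos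
    have hpos' := (Complex.le_def.1 hpos).1
    simp only [Complex.sub_re, Complex.re_sum, Complex.natCast_re, Complex.zero_re] at hpos'
    have hs : ∑ j : Fin m, (P j j).re = (∑ j : Fin m, (if (j : ℕ) < k then P j j else 0).re) +
        ∑ j : Fin m, if k ≤ (j : ℕ) then (P j j).re else 0 := by
      rw [← Finset.sum_add_distrib]
      refine Finset.sum_congr rfl fun j _ => ?_
      by_cases hj : (j : ℕ) < k
      · simp [hj, not_le.2 hj]
      · simp [hj, not_lt.1 hj]
    have ht := sum_jump_tail K hk
    have : (∑ j : Fin m, if k ≤ (j : ℕ) then jump K j - (P j j).re else 0) =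
        (∑ j : Fin m, if k ≤ (j : ℕ) then jump K j else 0) -
        ∑ j : Fin m, if k ≤ (j : ℕ) then (P j j).re else 0 := by
      rw [← Finset.sum_sub_distrib]
      refine Finset.sum_congr rfl fun j _ => ?_
      split_ifs <;> simp
    rw [this, ht]
    linarith
  · rw [Finset.sum_sub_distrib, sum_jump, htr, sub_self]

end Projection

section LogDet

open scoped ComplexOrder
open Filter Topology Module

theorem tendsto_mul_exp_sub_one (a : ℝ) :
    Tendsto (fun N : ℕ => ((N : ℝ) + 1) * (Real.exp (a / (N + 1)) - 1)) atTop (𝓝 a) := by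
  have h : HasDerivAt (fun t : ℝ => Real.exp (a * t)) a 0 := by
    have := ((hasDerivAt_id (0 : ℝ)).const_mul a).exp
    simpa using this
  have h1 := h.tendsto_slope_zero_right
  have h2 : Tendsto (fun N : ℕ => 1 / ((N : ℝ) + 1)) atTop (𝓝[>] 0) :=
    tendsto_nhdsWithin_iff.2 ⟨tendsto_one_div_add_atTop_nhds_zero_nat,
      .of_forall fun N => by simp only [Set.mem_Ioi]; positivity⟩
  refine (h1.comp h2).congr fun N => ?_
  simp [div_eq_mul_inv]

theorem posDef_conjTranspose_mul_mul {ι κ : Type*} [Fintype ι] [Fintype κ]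
    {x : Matrix ι ι ℂ} (hx : x.PosDef) {B : Matrix ι κ ℂ} (hB : Function.Injective B.mulVec) :
    (Bᴴ * x * B).PosDef :=
  hx.conjTranspose_mul_mul_same hB

theorem det_re_pos {ι : Type*} [Fintype ι] [DecidableEq ι] {x : Matrix ι ι ℂ} (hx : x.PosDef) :
    0 < x.det.re := (Complex.lt_def.1 hx.det_pos).1

theorem ofReal_det_re {ι : Type*} [Fintype ι] [DecidableEq ι] {x : Matrix ι ι ℂ}
    (hx : x.IsHermitian) : ((x.det.re : ℝ) : ℂ) = x.det := by
  have h : star x.det = x.det := by rw [← det_conjTranspose, hx.eq]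
  exact Complex.conj_eq_iff_re.1 h

theorem log_det_le_trace_sub {ι : Type*} [Fintype ι] [DecidableEq ι] {x : Matrix ι ι ℂ}
    (hx : x.PosDef) : Real.log x.det.re ≤ x.trace.re - Fintype.card ι := by
  have h1 : x.det.re = ∏ i, hx.isHermitian.eigenvalues i := by
    rw [hx.isHermitian.det_eq_prod_eigenvalues, ← Complex.ofReal_re (∏ i, _)]
    congr 1
    push_cast
    rfl
  have h2 : x.trace.re = ∑ i, hx.isHermitian.eigenvalues i := by
    rw [hx.isHermitian.trace_eq_sum_eigenvalues, ← Complex.ofReal_re (∑ i, _)]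
    congr 1
    push_cast
    rfl
  rw [h1, h2, Real.log_prod fun i _ => (hx.eigenvalues_pos i).ne']
  have : ∑ i, hx.isHermitian.eigenvalues i - Fintype.card ι =
      ∑ i, (hx.isHermitian.eigenvalues i - 1) := by
    simp [Finset.sum_sub_distrib, -Complex.ofReal_exp]
  rw [this]
  exact Finset.sum_le_sum fun i _ => Real.log_le_sub_one_of_pos (hx.eigenvalues_pos i)

theorem log_det_conj {ι : Type*} [Fintype ι] [DecidableEq ι] {x S : Matrix ι ι ℂ}
    (hx : x.PosDef) (hS : IsUnit S.det) :
    Real.log (Sᴴ * x * S).det.re = Real.log x.det.re + Real.log (Sᴴ * S).det.re := by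
  have hinj : Function.Injective S.mulVec :=
    mulVec_injective_of_isUnit ((isUnit_iff_isUnit_det S).2 hS)
  have h1 := det_re_pos hx
  have h2 : (Sᴴ * S).PosDef := by
    simpa using posDef_conjTranspose_mul_mul PosDef.one hinj
  have h3 := det_re_pos h2
  rw [← Real.log_mul h1.ne' h3.ne']
  congr 1
  have : (Sᴴ * x * S).det = x.det * (Sᴴ * S).det := by
    simp only [det_mul]; ring
  rw [this, ← ofReal_det_re hx.isHermitian, ← ofReal_det_re h2.isHermitian, ← Complex.ofReal_mul,
    Complex.ofReal_re]
  simp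

variable {m q : ℕ}

theorem posDef_diagonal_exp (β : Fin m → ℝ) :
    (diagonal fun j => ((Real.exp (β j) : ℝ) : ℂ)).PosDef :=
  .diagonal fun j => by
    have := Real.exp_pos (β j)
    exact_mod_cast this

theorem log_det_step {B : Matrix (Fin m) (Fin q) ℂ} (hB : Function.Injective B.mulVec)
    {β : Fin m → ℝ} (hβ : Monotone β) :
    Real.log (Bᴴ * (diagonal fun j => ((Real.exp (β j) : ℝ) : ℂ)) * B).det.re -
      Real.log (Bᴴ * B).det.re ≤
      ∑ j, (Real.exp (β j) - 1) * jump (LinearMap.range B.mulVecLin) j := by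
  set D : Matrix (Fin m) (Fin m) ℂ := diagonal fun j => ((Real.exp (β j) : ℝ) : ℂ) with hD
  have hM : (Bᴴ * B).PosDef := by
    simpa using posDef_conjTranspose_mul_mul PosDef.one hB
  obtain ⟨S, hS⟩ := exists_eq_conjTranspose_mul_self hM.posSemidef
  have hSu : IsUnit S.det := by
    have := (isUnit_iff_isUnit_det _).1 hM.isUnit
    rw [hS, det_mul] at this
    exact isUnit_of_mul_isUnit_right this
  set C := B * S⁻¹ with hC
  have hBC : B = C * S := by rw [hC, nonsing_inv_mul_cancel_right _ _ hSu]
  have hSinj : Function.Injective S⁻¹.mulVec :=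
    mulVec_injective_of_isUnit ((isUnit_iff_isUnit_det _).2 (isUnit_nonsing_inv_det _ hSu))
  have hCinj : Function.Injective C.mulVec := by
    intro v w hvw
    rw [hC, ← mulVec_mulVec, ← mulVec_mulVec] at hvw
    exact hSinj (hB hvw)
  have hCC : Cᴴ * C = 1 := by
    have : Cᴴ * C = (S⁻¹)ᴴ * (Bᴴ * B) * S⁻¹ := by
      rw [hC, conjTranspose_mul]; simp only [Matrix.mul_assoc]
    rw [this, hS, conjTranspose_nonsing_inv, ← Matrix.mul_assoc, nonsing_inv_mul _ (by
      rw [det_conjTranspose]; exact hSu.star), Matrix.one_mul, mul_nonsing_inv _ hSu]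
  have hrange : LinearMap.range (C * Cᴴ).mulVecLin = LinearMap.range B.mulVecLin := by
    apply le_antisymm
    · rintro _ ⟨v, rfl⟩
      exact ⟨S⁻¹ *ᵥ (Cᴴ *ᵥ v), by simp [hC, mulVec_mulVec, Matrix.mul_assoc]⟩
    · rintro _ ⟨v, rfl⟩
      refine ⟨B *ᵥ v, ?_⟩
      rw [mulVecLin_apply, mulVecLin_apply, mulVec_mulVec]
      congr 1
      rw [hBC, Matrix.mul_assoc, ← Matrix.mul_assoc Cᴴ, hCC, Matrix.one_mul]
  have h1 : Bᴴ * D * B = Sᴴ * (Cᴴ * D * C) * S := by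
    rw [hBC, conjTranspose_mul]; simp only [Matrix.mul_assoc]
  have hN : (Cᴴ * D * C).PosDef := posDef_conjTranspose_mul_mul (posDef_diagonal_exp β) hCinj
  have h2 := log_det_le_trace_sub hN
  have h3 := sum_mul_re_diag_le (P := C * Cᴴ) (isHermitian_mul_conjTranspose_self C)
    (by rw [Matrix.mul_assoc, ← Matrix.mul_assoc Cᴴ, hCC, Matrix.one_mul])
    (β := fun j => Real.exp (β j) - 1)
    (fun a b hab => sub_le_sub_right (Real.exp_le_exp.2 (hβ hab)) _)
  rw [hrange] at h3
  have h4 : (Cᴴ * D * C).trace.re - q = ∑ j, (Real.exp (β j) - 1) * ((C * Cᴴ) j j).re := by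
    have e1 : (q : ℝ) = (C * Cᴴ).trace.re := by
      rw [trace_mul_conjTranspose_isometry hCC]; simp
    rw [Matrix.mul_assoc, trace_mul_comm, Matrix.mul_assoc, e1]
    simp [trace, hD, diagonal_mul, sub_mul, Finset.sum_sub_distrib, -Complex.ofReal_exp]
  rw [h1, log_det_conj hN hSu, hS, add_sub_cancel_right]
  rw [Fintype.card_fin] at h2
  linarith

/-- The logarithmic determinant of a compressed diagonal flow grows at most by the pairing with
the jumps of the range. -/
theorem log_det_exp_le {B : Matrix (Fin m) (Fin q) ℂ} (hB : Function.Injective B.mulVec)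
    {β : Fin m → ℝ} (hβ : Monotone β) :
    Real.log (Bᴴ * (diagonal fun j => ((Real.exp (β j) : ℝ) : ℂ)) * B).det.re -
      Real.log (Bᴴ * B).det.re ≤ ∑ j, β j * jump (LinearMap.range B.mulVecLin) j := by
  set f : ℝ → ℝ := fun t =>
    Real.log (Bᴴ * (diagonal fun j => ((Real.exp (t * β j) : ℝ) : ℂ)) * B).det.re with hf
  have hstep : ∀ s t : ℝ, 0 ≤ t → f (s + t) - f s ≤
      ∑ j, (Real.exp (t * β j) - 1) * jump (LinearMap.range B.mulVecLin) j := by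
    intro s t ht
    set D : Matrix (Fin m) (Fin m) ℂ := diagonal fun j => ((Real.exp (s * β j / 2) : ℝ) : ℂ)
      with hD
    have hDne : ∀ j, ((Real.exp (s * β j / 2) : ℝ) : ℂ) ≠ 0 := fun j => by
      exact_mod_cast (Real.exp_pos _).ne'
    have hDH : Dᴴ = D := by
      rw [hD, diagonal_conjTranspose]
      congr 1
      funext j
      simp only [Pi.star_apply]
      exact Complex.conj_ofReal _
    have hinj : Function.Injective (D * B).mulVec := by
      intro v w hvw
      rw [← mulVec_mulVec, ← mulVec_mulVec] at hvw
      refine hB (funext fun j => mul_left_cancel₀ (hDne j) ?_)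
      simpa [hD, mulVec_diagonal] using congrFun hvw j
    have h := log_det_step hinj (β := fun j => t * β j)
      (fun a b hab => mul_le_mul_of_nonneg_left (hβ hab) ht)
    have hr : LinearMap.range (D * B).mulVecLin = (LinearMap.range B.mulVecLin).map D.mulVecLin := by
      rw [mulVecLin_mul, LinearMap.range_comp]
    rw [hr, hD, jump_map_diagonal _ hDne, ← hD] at h
    have e1 : (D * B)ᴴ * (D * B) =
        Bᴴ * (diagonal fun j => ((Real.exp (s * β j) : ℝ) : ℂ)) * B := by
      rw [conjTranspose_mul, hDH, Matrix.mul_assoc, ← Matrix.mul_assoc D, hD,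
        diagonal_mul_diagonal, ← Matrix.mul_assoc]
      congr 3
      funext j
      rw [← Complex.ofReal_mul, ← Real.exp_add, add_halves]
    have e2 : (D * B)ᴴ * (diagonal fun j => ((Real.exp (t * β j) : ℝ) : ℂ)) * (D * B) =
        Bᴴ * (diagonal fun j => ((Real.exp ((s + t) * β j) : ℝ) : ℂ)) * B := by
      rw [conjTranspose_mul, hDH, Matrix.mul_assoc Bᴴ, hD, diagonal_mul_diagonal,
        Matrix.mul_assoc, ← Matrix.mul_assoc (diagonal _), diagonal_mul_diagonal,
        ← Matrix.mul_assoc]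
      congr 3
      funext j
      rw [← Complex.ofReal_mul, ← Complex.ofReal_mul, ← Real.exp_add, ← Real.exp_add]
      ring_nf
    rw [e1, e2] at h
    exact h
  have hiter : ∀ (t : ℝ), 0 ≤ t → ∀ N : ℕ, f (N * t) - f 0 ≤
      N * ∑ j, (Real.exp (t * β j) - 1) * jump (LinearMap.range B.mulVecLin) j := by
    intro t ht N
    induction N with
    | zero => simp
    | succ N ih =>
      have := hstep (N * t) t ht
      push_cast
      rw [add_mul, add_mul, one_mul, one_mul]
      linarith
  have hlim : Tendsto (fun N : ℕ => ∑ j, (((N : ℝ) + 1) * (Real.exp (β j / (N + 1)) - 1)) *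
      jump (LinearMap.range B.mulVecLin) j) atTop
      (𝓝 (∑ j, β j * jump (LinearMap.range B.mulVecLin) j)) :=
    tendsto_finsetSum _ fun j _ => (tendsto_mul_exp_sub_one (β j)).mul_const _
  have hle : f 1 - f 0 ≤ ∑ j, β j * jump (LinearMap.range B.mulVecLin) j := by
    refine ge_of_tendsto' hlim fun N => ?_
    have hN : (0 : ℝ) < (N : ℝ) + 1 := by positivity
    have := hiter (1 / ((N : ℝ) + 1)) (by positivity) (N + 1)
    push_cast at this
    rw [mul_one_div_cancel hN.ne', Finset.mul_sum] at this
    refine this.trans (le_of_eq (Finset.sum_congr rfl fun j _ => ?_))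
    rw [mul_assoc, one_div_mul_eq_div]
  simpa [hf] using hle

end LogDet

section Semistable

open scoped ComplexOrder
open Filter Topology Module

variable {m : ℕ}

/-- The diagonal matrix with entries `exp (β j)`. -/
noncomputable def expDiag (β : Fin m → ℝ) : Matrix (Fin m) (Fin m) ℂ :=
  diagonal fun j => ((Real.exp (β j) : ℝ) : ℂ)

theorem det_expDiag {β : Fin m → ℝ} (hβ : ∑ j, β j = 0) : (expDiag β).det = 1 := by
  rw [expDiag, det_diagonal, ← Complex.ofReal_prod, ← Real.exp_sum, hβ]
  simp

/-- Semistability of the configuration of weighted flags given by the frames `E i`, `i < n`, and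
the weights `β i`. -/
def Semistable (n : ℕ) (E : ℕ → Matrix (Fin m) (Fin m) ℂ) (β : ℕ → Fin m → ℝ) : Prop :=
  ∀ K : Submodule ℂ (Fin m → ℂ),
    0 ≤ ∑ i ∈ Finset.range n, ∑ j, β i j * jump (K.map (E i).mulVecLin) j

theorem Semistable.smul {n : ℕ} {E : ℕ → Matrix (Fin m) (Fin m) ℂ} {β : ℕ → Fin m → ℝ}
    (h : Semistable n E β) {t : ℝ} (ht : 0 ≤ t) : Semistable n E (t • β) := by
  intro K
  have := mul_nonneg ht (h K)
  simpa [Finset.mul_sum, mul_assoc] using this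

theorem semistable_of_sum_eq_zero {n : ℕ} {U : ℕ → Matrix (Fin m) (Fin m) ℂ}
    {β : ℕ → Fin m → ℝ} (hβ : ∀ i, Monotone (β i)) (hU : ∀ i, (U i)ᴴ * U i = 1)
    (h : ∑ i ∈ Finset.range n, U i * (diagonal fun j => (β i j : ℂ)) * (U i)ᴴ = 0) :
    Semistable n (fun i => (U i)ᴴ) β := by
  intro K
  obtain ⟨q, C, hC, hr⟩ : ∃ (q : ℕ) (C : Matrix (Fin m) (Fin q) ℂ), Cᴴ * C = 1 ∧
      LinearMap.range C.mulVecLin = K := ⟨_, exists_isometry K⟩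
  have key : ∀ i, ((U i * (diagonal fun j => (β i j : ℂ)) * (U i)ᴴ) * (C * Cᴴ)).trace.re ≤
      ∑ j, β i j * jump (K.map (U i)ᴴ.mulVecLin) j := by
    intro i
    have hU' : U i * (U i)ᴴ = 1 := mul_eq_one_comm.1 (hU i)
    set W := (U i)ᴴ * C with hW
    have hWW : Wᴴ * W = 1 := by
      rw [hW, conjTranspose_mul, conjTranspose_conjTranspose, Matrix.mul_assoc,
        ← Matrix.mul_assoc (U i), hU', Matrix.one_mul, hC]
    have h1 := sum_mul_re_diag_le (P := W * Wᴴ) (isHermitian_mul_conjTranspose_self W)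
      (by rw [Matrix.mul_assoc, ← Matrix.mul_assoc Wᴴ, hWW, Matrix.one_mul]) (hβ i)
    have h2 : LinearMap.range (W * Wᴴ).mulVecLin = K.map (U i)ᴴ.mulVecLin := by
      rw [← hr, ← LinearMap.range_comp, ← mulVecLin_mul, ← hW]
      apply le_antisymm
      · rintro _ ⟨v, rfl⟩
        exact ⟨Wᴴ *ᵥ v, by simp [mulVec_mulVec]⟩
      · rintro _ ⟨v, rfl⟩
        refine ⟨W *ᵥ v, ?_⟩
        rw [mulVecLin_apply, mulVecLin_apply, mulVec_mulVec, Matrix.mul_assoc, hWW, Matrix.mul_one]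
    rw [h2] at h1
    refine le_of_eq_of_le ?_ h1
    have h3 : ((U i * (diagonal fun j => (β i j : ℂ)) * (U i)ᴴ) * (C * Cᴴ)).trace =
        ((diagonal fun j => (β i j : ℂ)) * (W * Wᴴ)).trace := by
      rw [Matrix.mul_assoc, Matrix.mul_assoc, trace_mul_comm, hW, conjTranspose_mul,
        conjTranspose_conjTranspose]
      simp only [Matrix.mul_assoc]
    rw [h3]
    simp [trace, diagonal_mul]
  calc (0 : ℝ) = ((∑ i ∈ Finset.range n, U i * (diagonal fun j => (β i j : ℂ)) * (U i)ᴴ) *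
        (C * Cᴴ)).trace.re := by rw [h]; simp
    _ = ∑ i ∈ Finset.range n,
        ((U i * (diagonal fun j => (β i j : ℂ)) * (U i)ᴴ) * (C * Cᴴ)).trace.re := by
      rw [Finset.sum_mul, trace_sum, Complex.re_sum]
    _ ≤ _ := Finset.sum_le_sum fun i _ => key i

theorem mulVec_injective_of_isometry {κ : Type*} [Fintype κ] [DecidableEq κ]
    {C : Matrix (Fin m) κ ℂ} (hC : Cᴴ * C = 1) : Function.Injective C.mulVec := by
  intro v w hvw
  have := congrArg (Cᴴ *ᵥ ·) hvw
  simpa [mulVec_mulVec, hC] using this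

/-- A closed polygon of positive definite matrices whose side `i` is described by the frame `E i`
and the weight `β i` yields a semistable configuration. -/
theorem semistable_of_chain {n : ℕ} {x E : ℕ → Matrix (Fin m) (Fin m) ℂ}
    {β : ℕ → Fin m → ℝ} (hβ : ∀ i, Monotone (β i)) (hE : ∀ i, IsUnit (E i).det)
    (h0 : ∀ i, x i = (E i)ᴴ * E i) (h1 : ∀ i, x (i + 1) = (E i)ᴴ * expDiag (β i) * E i)
    (hx : x n = x 0) : Semistable n E β := by
  intro K
  obtain ⟨C, hC, hr⟩ := exists_isometry K
  have hinj : ∀ i, Function.Injective (E i * C).mulVec := by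
    intro i v w hvw
    rw [← mulVec_mulVec, ← mulVec_mulVec] at hvw
    exact mulVec_injective_of_isometry hC
      (mulVec_injective_of_isUnit ((isUnit_iff_isUnit_det _).2 (hE i)) hvw)
  have key : ∀ i, Real.log (Cᴴ * x (i + 1) * C).det.re - Real.log (Cᴴ * x i * C).det.re ≤
      ∑ j, β i j * jump (K.map (E i).mulVecLin) j := by
    intro i
    have h := log_det_exp_le (hinj i) (hβ i)
    rw [mulVecLin_mul, LinearMap.range_comp, hr] at h
    rw [h0 i, h1 i]
    simpa only [conjTranspose_mul, Matrix.mul_assoc, expDiag] using h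
  calc (0 : ℝ) = ∑ i ∈ Finset.range n,
        (Real.log (Cᴴ * x (i + 1) * C).det.re - Real.log (Cᴴ * x i * C).det.re) := by
          rw [Finset.sum_range_sub fun i => Real.log (Cᴴ * x i * C).det.re, hx, sub_self]
    _ ≤ _ := Finset.sum_le_sum fun i _ => key i

theorem semistable_of_prod {n : ℕ} {g h U : ℕ → Matrix (Fin m) (Fin m) ℂ}
    {β : ℕ → Fin m → ℝ} (hβ : ∀ i, Monotone (β i)) (hU : ∀ i, (U i)ᴴ * U i = 1)
    (hg : ∀ i, IsUnit (g i).det) (hgU : ∀ i, g i * (g i)ᴴ = U i * expDiag (β i) * (U i)ᴴ)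
    (h0 : h 0 = 1) (hs : ∀ i, h (i + 1) = h i * g i) (hn : h n = 1) :
    Semistable n (fun i => (h i * U i)ᴴ) β := by
  have hh : ∀ i, IsUnit (h i).det := by
    intro i
    induction i with
    | zero => simp [h0]
    | succ i ih => rw [hs, det_mul]; exact ih.mul (hg i)
  refine semistable_of_chain (x := fun i => h i * (h i)ᴴ) hβ (fun i => ?_) (fun i => ?_)
    (fun i => ?_) (by rw [hn, h0])
  · rw [det_conjTranspose, det_mul]
    refine ((hh i).mul ?_).star
    have := congrArg det (hU i)
    rw [det_mul, det_one] at this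
    exact IsUnit.of_mul_eq_one_right _ this
  · have hU' : U i * (U i)ᴴ = 1 := mul_eq_one_comm.1 (hU i)
    simp only [conjTranspose_mul, conjTranspose_conjTranspose]
    rw [Matrix.mul_assoc, ← Matrix.mul_assoc (U i), hU', Matrix.one_mul]
  · simp only [conjTranspose_mul, conjTranspose_conjTranspose, hs]
    calc h i * g i * ((g i)ᴴ * (h i)ᴴ) = h i * (g i * (g i)ᴴ) * (h i)ᴴ := by
          simp only [Matrix.mul_assoc]
      _ = _ := by rw [hgU]; simp only [Matrix.mul_assoc]

end Semistable

section Step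

open scoped ComplexOrder
open Filter Topology Module

variable {m : ℕ}

/-- `Step E β x x'`: the positive semidefinite form `x'` is obtained from `x` by following the
ray of weight `β` that ends in the flag with frame `E`. -/
def Step (E : Matrix (Fin m) (Fin m) ℂ) (β : Fin m → ℝ) (x x' : Matrix (Fin m) (Fin m) ℂ) : Prop :=
  ∃ R : Matrix (Fin m) (Fin m) ℂ, R.BlockTriangular id ∧ x = (R * E)ᴴ * (R * E) ∧
    x' = (R * E)ᴴ * expDiag β * (R * E)

theorem exists_cholesky {x : Matrix (Fin m) (Fin m) ℂ} (hx : x.PosDef) :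
    ∃ R : Matrix (Fin m) (Fin m) ℂ, R.BlockTriangular id ∧ x = Rᴴ * R := by
  set L := LDL.lowerInv hx with hL
  have hLinv : IsUnit L := isUnit_of_invertible L
  have hinj : Function.Injective Lᴴ.mulVec :=
    mulVec_injective_of_isUnit (hLinv.star)
  have hD : (LDL.diag hx).PosDef := by
    rw [LDL.diag_eq_lowerInv_conj]
    simpa using posDef_conjTranspose_mul_mul hx hinj
  have hd : ∀ i, 0 < LDL.diagEntries hx i := fun i => by
    have := hD.diag_pos (i := i)
    simpa [LDL.diag] using this
  have hupper : (LDL.lower hx)ᴴ.BlockTriangular id := by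
    rw [LDL.lower, conjTranspose_nonsing_inv]
    have htri : Lᴴ.BlockTriangular id := fun i j (hij : j < i) => by
      rw [conjTranspose_apply, hL, LDL.lowerInv_triangular hx hij, star_zero]
    let : Invertible Lᴴ := hLinv.star.invertible
    exact blockTriangular_inv_of_blockTriangular htri
  refine ⟨diagonal (fun j => ((√(LDL.diagEntries hx j).re : ℝ) : ℂ)) * (LDL.lower hx)ᴴ,
    (blockTriangular_diagonal _).mul hupper, ?_⟩
  have hsq : LDL.diag hx = diagonal (fun j => ((√(LDL.diagEntries hx j).re : ℝ) : ℂ)) *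
      diagonal (fun j => ((√(LDL.diagEntries hx j).re : ℝ) : ℂ)) := by
    rw [diagonal_mul_diagonal, LDL.diag]
    congr 1
    funext j
    have h := Complex.lt_def.1 (hd j)
    rw [← Complex.ofReal_mul, Real.mul_self_sqrt h.1.le]
    exact Complex.ext rfl h.2.symm
  have hH : (diagonal (fun j => ((√(LDL.diagEntries hx j).re : ℝ) : ℂ)))ᴴ =
      diagonal (fun j => ((√(LDL.diagEntries hx j).re : ℝ) : ℂ)) := by
    rw [diagonal_conjTranspose]
    congr 1
    funext j
    exact Complex.conj_ofReal _
  rw [conjTranspose_mul, conjTranspose_conjTranspose, hH, Matrix.mul_assoc,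
    ← Matrix.mul_assoc (diagonal _), ← hsq, ← Matrix.mul_assoc]
  exact (LDL.lower_conj_diag hx).symm

theorem mulVec_mem_coordSub {R : Matrix (Fin m) (Fin m) ℂ} (hR : R.BlockTriangular id) {k : ℕ}
    {v : Fin m → ℂ} (hv : v ∈ coordSub m k) : R *ᵥ v ∈ coordSub m k := by
  intro i hi
  rw [mulVec, dotProduct]
  refine Finset.sum_eq_zero fun j _ => ?_
  by_cases hj : k ≤ (j : ℕ)
  · rw [hv j hj, mul_zero]
  · rw [hR (show j < i from Fin.lt_def.2 (by omega)), zero_mul]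

variable {E : Matrix (Fin m) (Fin m) ℂ} {β : Fin m → ℝ} {x x' y y' : Matrix (Fin m) (Fin m) ℂ}

theorem exists_step (hE : IsUnit E.det) (β : Fin m → ℝ) (hx : x.PosDef) :
    ∃ x', Step E β x x' := by
  have hinj : Function.Injective E⁻¹.mulVec :=
    mulVec_injective_of_isUnit ((isUnit_iff_isUnit_det _).2 (isUnit_nonsing_inv_det _ hE))
  obtain ⟨R, hR, h⟩ := exists_cholesky (posDef_conjTranspose_mul_mul hx hinj)
  refine ⟨_, R, hR, ?_, rfl⟩
  have : (R * E)ᴴ * (R * E) = Eᴴ * (Rᴴ * R) * E := by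
    rw [conjTranspose_mul]; simp only [Matrix.mul_assoc]
  rw [this, ← h, conjTranspose_nonsing_inv]
  have hE' : IsUnit Eᴴ.det := by rw [det_conjTranspose]; exact hE.star
  rw [Matrix.mul_assoc, Matrix.mul_assoc (Eᴴ⁻¹ * x), nonsing_inv_mul _ hE, Matrix.mul_one,
    mul_nonsing_inv_cancel_left _ _ hE']

theorem qf_conjTranspose_mul_expDiag_mul (T : Matrix (Fin m) (Fin m) ℂ) (β : Fin m → ℝ)
    (v : Fin m → ℂ) :
    qf (Tᴴ * expDiag β * T) v = ∑ j, Real.exp (β j) * ‖(T *ᵥ v) j‖ ^ 2 := by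
  rw [qf_conj, expDiag, qf_diagonal]

theorem posSemidef_conjTranspose_mul_expDiag_mul (T : Matrix (Fin m) (Fin m) ℂ) (β : Fin m → ℝ) :
    (Tᴴ * expDiag β * T).PosSemidef :=
  (posDef_diagonal_exp β).posSemidef.conjTranspose_mul_mul_same T

theorem Step.isUnit_det (h : Step E β x x') (hx : x.PosDef) :
    ∃ R : Matrix (Fin m) (Fin m) ℂ, R.BlockTriangular id ∧ x = (R * E)ᴴ * (R * E) ∧
    x' = (R * E)ᴴ * expDiag β * (R * E) ∧ IsUnit R.det ∧ IsUnit E.det := by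
  obtain ⟨R, hR, h0, h1⟩ := h
  have := (isUnit_iff_isUnit_det _).1 hx.isUnit
  rw [h0, det_mul, det_mul R] at this
  have h2 := isUnit_of_mul_isUnit_right this
  exact ⟨R, hR, h0, h1, isUnit_of_mul_isUnit_left h2, isUnit_of_mul_isUnit_right h2⟩

theorem Step.posDef (h : Step E β x x') (hx : x.PosDef) : x'.PosDef := by
  obtain ⟨R, -, -, rfl, hR, hE⟩ := h.isUnit_det hx
  exact posDef_conjTranspose_mul_mul (posDef_diagonal_exp β) (mulVec_injective_of_isUnit
    ((isUnit_iff_isUnit_det _).2 (by rw [det_mul]; exact hR.mul hE)))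

theorem Step.posSemidef (h : Step E β x x') : x'.PosSemidef := by
  obtain ⟨R, -, -, rfl⟩ := h
  exact posSemidef_conjTranspose_mul_expDiag_mul _ β

theorem Step.det_eq (h : Step E β x x') (hβ : ∑ j, β j = 0) : x'.det = x.det := by
  obtain ⟨R, -, rfl, rfl⟩ := h
  simp [det_mul, det_expDiag hβ]

/-- Following a ray is monotone and homogeneous. -/
theorem Step.mono (hβ : Monotone β) (hx : Step E β x x') (hy : Step E β y y') (hyp : y.PosDef)
    {c : ℝ} (h : ∀ v, qf x v ≤ c * qf y v) (v : Fin m → ℂ) : qf x' v ≤ c * qf y' v := by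
  obtain ⟨S, hS, rfl, rfl, hSu, hE⟩ := hy.isUnit_det hyp
  obtain ⟨R, hR, rfl, rfl⟩ := hx
  rw [qf_conjTranspose_mul_expDiag_mul, qf_conjTranspose_mul_expDiag_mul]
  simp only [qf_conjTranspose_mul_self, ← mulVec_mulVec] at h ⊢
  have hw : ∀ w : Fin m → ℂ, ∑ j, ‖(R *ᵥ w) j‖ ^ 2 ≤ c * ∑ j, ‖(S *ᵥ w) j‖ ^ 2 := by
    intro w
    have := h (E⁻¹ *ᵥ w)
    rwa [mulVec_mulVec w E, mul_nonsing_inv _ hE, one_mulVec] at this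
  generalize E *ᵥ v = w
  suffices 0 ≤ ∑ j, Real.exp (β j) * (c * ‖(S *ᵥ w) j‖ ^ 2 - ‖(R *ᵥ w) j‖ ^ 2) by
    simp only [mul_sub, Finset.sum_sub_distrib] at this
    rw [Finset.mul_sum]
    have e : ∀ j, c * (Real.exp (β j) * ‖(S *ᵥ w) j‖ ^ 2) =
      Real.exp (β j) * (c * ‖(S *ᵥ w) j‖ ^ 2) := fun j => by ring
    simp only [e]
    linarith
  refine sum_mul_nonneg_of_tail (fun a b hab => Real.exp_le_exp.2 (hβ hab)) (fun k _ => ?_)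
    (.inl fun j => (Real.exp_pos _).le)
  set p : Fin m → ℂ := fun j => if k ≤ (j : ℕ) then 0 else (S *ᵥ w) j with hp
  have hpk : p ∈ coordSub m k := fun i hi => if_pos hi
  have hz : S⁻¹ *ᵥ p ∈ coordSub m k := by
    let : Invertible S := ((isUnit_iff_isUnit_det _).2 hSu).invertible
    exact mulVec_mem_coordSub (blockTriangular_inv_of_blockTriangular hS) hpk
  have hRz := mulVec_mem_coordSub hR hz
  have hSz : S *ᵥ (S⁻¹ *ᵥ p) = p := by rw [mulVec_mulVec, mul_nonsing_inv _ hSu, one_mulVec]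
  have key := hw (w - S⁻¹ *ᵥ p)
  rw [mulVec_sub, mulVec_sub, hSz] at key
  have e1 : ∑ j, ‖(S *ᵥ w - p) j‖ ^ 2 =
      ∑ j : Fin m, if k ≤ (j : ℕ) then ‖(S *ᵥ w) j‖ ^ 2 else 0 := by
    refine Finset.sum_congr rfl fun j _ => ?_
    rw [Pi.sub_apply, hp]
    dsimp only
    split_ifs <;> simp
  have e2 : (∑ j : Fin m, if k ≤ (j : ℕ) then ‖(R *ᵥ w) j‖ ^ 2 else 0) ≤
      ∑ j, ‖(R *ᵥ w - R *ᵥ S⁻¹ *ᵥ p) j‖ ^ 2 := by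
    refine Finset.sum_le_sum fun j _ => ?_
    split_ifs with hj
    · rw [Pi.sub_apply, hRz j hj, sub_zero]
    · positivity
  have e3 : (∑ j : Fin m, if k ≤ (j : ℕ) then c * ‖(S *ᵥ w) j‖ ^ 2 - ‖(R *ᵥ w) j‖ ^ 2 else 0) =
      c * (∑ j : Fin m, if k ≤ (j : ℕ) then ‖(S *ᵥ w) j‖ ^ 2 else 0) -
      ∑ j : Fin m, if k ≤ (j : ℕ) then ‖(R *ᵥ w) j‖ ^ 2 else 0 := by
    rw [Finset.mul_sum, ← Finset.sum_sub_distrib]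
    refine Finset.sum_congr rfl fun j _ => ?_
    split_ifs <;> simp
  rw [e3]
  rw [e1] at key
  linarith

/-- A (possibly degenerate) form has a successor that bounds the successors of its
perturbations. -/
theorem exists_step_limit (hE : IsUnit E.det) (hβ : Monotone β) (hx : x.PosSemidef) :
    ∃ x', Step E β x x' ∧ ∀ η : ℝ, 0 < η → ∃ δ : ℝ, 0 < δ ∧ ∀ y', Step E β (x + δ • 1) y' →
      ∀ v, qf y' v ≤ qf (x' + η • 1) v := by
  set δ : ℕ → ℝ := fun k => 1 / ((k : ℝ) + 1) with hδ
  have hδpos : ∀ k, 0 < δ k := fun k => by rw [hδ]; positivity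
  have hδlim : Tendsto δ atTop (𝓝 0) := tendsto_one_div_add_atTop_nhds_zero_nat
  have hpd : ∀ d : ℝ, 0 < d → (x + d • (1 : Matrix (Fin m) (Fin m) ℂ)).PosDef := fun d hd =>
    PosDef.posSemidef_add hx (PosDef.one.smul hd)
  choose X R hR hRx hRX using fun k => exists_step hE β (hpd (δ k) (hδpos k))
  have hbound : ∀ k, ((R k * E)ᴴ * (R k * E)).trace.re ≤ x.trace.re + m := by
    intro k
    rw [← hRx k]
    have : δ k ≤ 1 := by
      rw [hδ]
      exact div_le_one_of_le₀ (by linarith [(Nat.cast_nonneg k : (0 : ℝ) ≤ k)]) (by positivity)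
    simp only [trace_add, trace_smul, trace_one, Fintype.card_fin, Complex.add_re,
      Complex.real_smul, Complex.re_ofReal_mul, Complex.natCast_re]
    have : δ k * m ≤ m := mul_le_of_le_one_left (Nat.cast_nonneg m) this
    linarith
  obtain ⟨T, φ, hφ, hT⟩ := exists_tendsto_of_trace_conjTranspose_mul_self_le hbound
  have hlimR : Tendsto (fun k => R (φ k)) atTop (𝓝 (T * E⁻¹)) := by
    have hc : Continuous fun A : Matrix (Fin m) (Fin m) ℂ => A * E⁻¹ := by fun_prop
    refine ((hc.tendsto T).comp hT).congr fun k => ?_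
    simp [Matrix.mul_assoc, mul_nonsing_inv _ hE]
  have hTE : T * E⁻¹ * E = T := nonsing_inv_mul_cancel_right _ _ hE
  have hlimX : Tendsto (fun k => X (φ k)) atTop (𝓝 (Tᴴ * expDiag β * T)) := by
    have hc : Continuous fun A : Matrix (Fin m) (Fin m) ℂ => Aᴴ * expDiag β * A := by fun_prop
    refine ((hc.tendsto T).comp hT).congr fun k => ?_
    simp [hRX]
  refine ⟨Tᴴ * expDiag β * T, ⟨T * E⁻¹, fun i j hij => ?_, ?_, by rw [hTE]⟩, fun η hη => ?_⟩
  · have hc : Continuous fun A : Matrix (Fin m) (Fin m) ℂ => A i j := by fun_prop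
    refine tendsto_nhds_unique ((hc.tendsto _).comp hlimR) ?_
    refine tendsto_const_nhds.congr fun k => ?_
    exact (hR (φ k) hij).symm
  · rw [hTE]
    have hc : Continuous fun A : Matrix (Fin m) (Fin m) ℂ => Aᴴ * A := by fun_prop
    have hc' : Continuous fun d : ℝ => x + d • (1 : Matrix (Fin m) (Fin m) ℂ) := by fun_prop
    have h1 := (hc'.tendsto 0).comp (hδlim.comp hφ.tendsto_atTop)
    rw [zero_smul, add_zero] at h1
    refine tendsto_nhds_unique h1 (((hc.tendsto T).comp hT).congr fun k => ?_)
    exact (hRx (φ k)).symm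
  · obtain ⟨k, hk⟩ := (eventually_abs_qf_sub_le hlimX hη).exists
    refine ⟨δ (φ k), hδpos _, fun y' hy' v => ?_⟩
    have h1 := Step.mono hβ hy' ⟨R (φ k), hR _, hRx _, hRX _⟩ (hpd _ (hδpos _)) (c := 1)
      (fun v => by rw [one_mul]) v
    have h2 := (abs_le.1 (hk v)).2
    rw [qf_add, qf_smul, qf_one]
    linarith

end Step

section Degenerate

open scoped ComplexOrder
open Filter Topology Module

variable {m : ℕ}

theorem le_finrank_coordSub {k : ℕ} (hk : k ≤ m) : k ≤ finrank ℂ (coordSub m k) := by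
  let f : (Fin k → ℂ) →ₗ[ℂ] coordSub m k :=
    { toFun := fun w => ⟨fun i => if h : (i : ℕ) < k then w ⟨i, h⟩ else 0,
        fun i hi => dif_neg (not_lt.2 hi)⟩
      map_add' := fun v w => by
        ext i
        by_cases h : (i : ℕ) < k <;> simp [h]
      map_smul' := fun c w => by
        ext i
        by_cases h : (i : ℕ) < k <;> simp [h] }
  have hf : Function.Injective f := by
    intro v w hvw
    funext i
    have := congrFun (congrArg Subtype.val hvw) (Fin.castLE hk i)
    simpa [f] using this
  simpa using LinearMap.finrank_le_finrank_of_injective hf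

theorem sum_ite_le {k : ℕ} (hk : k ≤ m) :
    (∑ j : Fin m, if k ≤ (j : ℕ) then (1 : ℝ) else 0) = m - k := by
  rw [Fin.sum_univ_eq_sum_range fun j => if k ≤ j then (1 : ℝ) else 0]
  induction m, hk using Nat.le_induction with
  | base => rw [sub_self]; exact Finset.sum_eq_zero fun j hj => if_neg (by simpa using hj)
  | succ n hn ih => rw [Finset.sum_range_succ, ih, if_pos hn]; push_cast; ring

/-- For an upper triangular matrix the jumps of range and kernel together sit at least as low as
the full flag. -/
theorem sum_mul_jump_range_add_ker_le {R : Matrix (Fin m) (Fin m) ℂ} (hR : R.BlockTriangular id)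
    {β : Fin m → ℝ} (hβ : Monotone β) (hβ0 : ∑ j, β j = 0) :
    ∑ j, β j * jump (LinearMap.range R.mulVecLin) j +
      ∑ j, β j * jump (LinearMap.ker R.mulVecLin) j ≤ 0 := by
  set A := LinearMap.range R.mulVecLin with hA
  set B := LinearMap.ker R.mulVecLin with hB
  have hrn : (finrank ℂ A : ℝ) + finrank ℂ B = m := by
    have := LinearMap.finrank_range_add_finrank_ker R.mulVecLin
    rw [finrank_fin_fun] at this
    exact_mod_cast this
  suffices 0 ≤ ∑ j, β j * (1 - jump A j - jump B j) by
    simp only [mul_sub, Finset.sum_sub_distrib, mul_one, hβ0] at this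
    linarith
  refine sum_mul_nonneg_of_tail hβ (fun k hk => ?_) (.inr ?_)
  · have e : (∑ j : Fin m, if k ≤ (j : ℕ) then 1 - jump A j - jump B j else 0) =
        (∑ j : Fin m, if k ≤ (j : ℕ) then (1 : ℝ) else 0) -
        (∑ j : Fin m, if k ≤ (j : ℕ) then jump A j else 0) -
        ∑ j : Fin m, if k ≤ (j : ℕ) then jump B j else 0 := by
      rw [← Finset.sum_sub_distrib, ← Finset.sum_sub_distrib]
      refine Finset.sum_congr rfl fun j _ => ?_
      split_ifs <;> simp
    rw [e, sum_ite_le hk, sum_jump_tail A hk, sum_jump_tail B hk]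
    set f := R.mulVecLin.domRestrict (coordSub m k) with hf
    have h1 : finrank ℂ (LinearMap.range f) ≤ finrank ℂ ↥(A ⊓ coordSub m k) := by
      refine Submodule.finrank_mono ?_
      rintro _ ⟨v, rfl⟩
      exact ⟨⟨v, rfl⟩, mulVec_mem_coordSub hR v.2⟩
    have h2 : finrank ℂ (LinearMap.ker f) ≤ finrank ℂ ↥(B ⊓ coordSub m k) := by
      rw [← Submodule.finrank_map_subtype_eq]
      refine Submodule.finrank_mono ?_
      rintro _ ⟨v, hv, rfl⟩
      exact ⟨hv, v.2⟩
    have h3 := LinearMap.finrank_range_add_finrank_ker f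
    have h4 := le_finrank_coordSub hk
    have h5 : (k : ℝ) ≤ finrank ℂ ↥(A ⊓ coordSub m k) + finrank ℂ ↥(B ⊓ coordSub m k) := by
      exact_mod_cast (by omega : k ≤ finrank ℂ ↥(A ⊓ coordSub m k) + finrank ℂ ↥(B ⊓ coordSub m k))
    linarith
  · simp only [Finset.sum_sub_distrib, sum_jump]
    simp
    linarith

theorem log_det_mono {ι : Type*} [Fintype ι] [DecidableEq ι] {x y : Matrix ι ι ℂ}
    (hx : x.PosDef) (hy : y.PosDef) (h : ∀ v, qf x v ≤ qf y v) :
    Real.log x.det.re ≤ Real.log y.det.re := by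
  obtain ⟨S, rfl⟩ := exists_eq_conjTranspose_mul_self hy.posSemidef
  have hS : IsUnit S.det := by
    have := (isUnit_iff_isUnit_det _).1 hy.isUnit
    rw [det_mul] at this
    exact isUnit_of_mul_isUnit_right this
  have hinj : Function.Injective S⁻¹.mulVec :=
    mulVec_injective_of_isUnit ((isUnit_iff_isUnit_det _).2 (isUnit_nonsing_inv_det _ hS))
  set z := (S⁻¹)ᴴ * x * S⁻¹ with hz
  have hzp : z.PosDef := posDef_conjTranspose_mul_mul hx hinj
  have hS' : IsUnit Sᴴ.det := by rw [det_conjTranspose]; exact hS.star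
  have hxz : x = Sᴴ * z * S := by
    rw [hz, Matrix.mul_assoc Sᴴ, nonsing_inv_mul_cancel_right _ _ hS, conjTranspose_nonsing_inv,
      mul_nonsing_inv_cancel_left _ _ hS']
  have hle : ∀ v, qf z v ≤ ∑ j, ‖v j‖ ^ 2 := by
    intro v
    rw [hz, qf_conj]
    refine (h _).trans (le_of_eq ?_)
    rw [qf_conjTranspose_mul_self, mulVec_mulVec, mul_nonsing_inv _ hS, one_mulVec]
  have htr : z.trace.re ≤ Fintype.card ι := by
    rw [trace, Complex.re_sum, ← nsmul_one, ← Finset.card_univ]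
    refine Finset.sum_le_card_nsmul _ _ _ fun j _ => ?_
    have := hle (Pi.single j 1)
    rw [qf, mulVec_single_one] at this
    rw [show star (Pi.single j 1 : ι → ℂ) = Pi.single j 1 by simp,
      single_one_dotProduct, col_apply] at this
    refine this.trans (le_of_eq ?_)
    rw [Finset.sum_eq_single j (fun i _ hi => by simp [hi]) (by simp)]
    simp
  have h1 := log_det_le_trace_sub hzp
  rw [hxz, log_det_conj hzp hS]
  linarith

/-- In a semistable configuration a nonzero form cannot grow along a chain of degenerate steps. -/
theorem Semistable.exists_qf_lt {n : ℕ} {E X : ℕ → Matrix (Fin m) (Fin m) ℂ} {β : ℕ → Fin m → ℝ}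
    (hss : Semistable n E β) (hE : ∀ i, IsUnit (E i).det) (hβ : ∀ i, Monotone (β i))
    (hβ0 : ∀ i, ∑ j, β i j = 0) (hX : ∀ i, Step (E i) (β i) (X i) (X (i + 1))) (h0 : X 0 ≠ 0)
    {s : ℝ} (hs : 1 < s) : ∃ v, qf (X n) v < s * qf (X 0) v := by
  by_contra! hcon
  choose R hR hX0 hX1 using hX
  have hker0 : ∀ i v, qf (X i) v = 0 ↔ (R i * E i) *ᵥ v = 0 := by
    intro i v
    rw [hX0, qf_conjTranspose_mul_self, Finset.sum_eq_zero_iff_of_nonneg fun _ _ => by positivity]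
    simp [funext_iff]
  have hker1 : ∀ i v, qf (X (i + 1)) v = 0 ↔ (R i * E i) *ᵥ v = 0 := by
    intro i v
    rw [hX1, qf_conjTranspose_mul_expDiag_mul,
      Finset.sum_eq_zero_iff_of_nonneg fun _ _ => by positivity]
    simp [funext_iff, (Real.exp_pos _).ne']
  set K := LinearMap.ker (R 0 * E 0).mulVecLin with hK
  have hker : ∀ i v, (R i * E i) *ᵥ v = 0 ↔ v ∈ K := by
    intro i v
    induction i with
    | zero => rfl
    | succ i ih => rw [← hker0, hker1, ih]
  obtain ⟨K', hKK⟩ := K.exists_isCompl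
  obtain ⟨q, C, hC, hr⟩ : ∃ (q : ℕ) (C : Matrix (Fin m) (Fin q) ℂ), Cᴴ * C = 1 ∧
      LinearMap.range C.mulVecLin = K' := ⟨_, exists_isometry K'⟩
  have hCinj := mulVec_injective_of_isometry hC
  have hq : 0 < q := by
    rcases Nat.eq_zero_or_pos q with rfl | hq
    · exfalso
      have hbot : K' = ⊥ := by
        rw [← hr]
        refine LinearMap.range_eq_bot.2 (LinearMap.ext fun v => ?_)
        rw [Subsingleton.elim v 0, map_zero, map_zero]
      have htop : K = ⊤ := by
        have := hKK.sup_eq_top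
        rwa [hbot, sup_bot_eq] at this
      have hT : R 0 * E 0 = 0 := by
        refine ext_of_mulVec_single fun i => ?_
        rw [zero_mulVec, hker 0, htop]
        trivial
      exact h0 (by rw [hX0, hT, Matrix.mul_zero])
    · exact hq
  have hinj : ∀ i, Function.Injective (R i * E i * C).mulVec := by
    intro i v w hvw
    apply hCinj
    rw [← sub_eq_zero, ← mulVec_sub]
    rw [← sub_eq_zero, ← mulVec_sub, ← mulVec_mulVec, hker] at hvw
    have hmem : C *ᵥ (v - w) ∈ K' := hr ▸ ⟨v - w, rfl⟩
    exact (Submodule.disjoint_def.1 hKK.disjoint) _ hvw hmem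
  have hrange : ∀ i, LinearMap.range (R i * E i * C).mulVecLin =
      LinearMap.range (R i).mulVecLin := by
    intro i
    apply le_antisymm
    · rintro _ ⟨v, rfl⟩
      exact ⟨E i *ᵥ C *ᵥ v, by simp [mulVec_mulVec]⟩
    · rintro _ ⟨w, rfl⟩
      have htop : (E i)⁻¹ *ᵥ w ∈ K ⊔ K' := hKK.sup_eq_top ▸ Submodule.mem_top
      obtain ⟨a, ha, b, hb, hab⟩ := Submodule.mem_sup.1 htop
      rw [← hr] at hb
      obtain ⟨u, rfl⟩ := hb
      refine ⟨u, ?_⟩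
      have h1 : w = E i *ᵥ (a + C *ᵥ u) := by
        rw [← mulVecLin_apply C, hab, mulVec_mulVec, mul_nonsing_inv _ (hE i), one_mulVec]
      rw [mulVecLin_apply, mulVecLin_apply, h1, mulVec_mulVec, mulVec_add, (hker i a).2 ha,
        zero_add, mulVec_mulVec]
  have hkerR : ∀ i, LinearMap.ker (R i).mulVecLin = K.map (E i).mulVecLin := by
    intro i
    ext w
    constructor
    · intro hw
      have e : E i *ᵥ (E i)⁻¹ *ᵥ w = w := by
        rw [mulVec_mulVec, mul_nonsing_inv _ (hE i), one_mulVec]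
      refine ⟨(E i)⁻¹ *ᵥ w, (hker i _).1 ?_, e⟩
      rw [← mulVec_mulVec, e]
      exact hw
    · rintro ⟨v, hv, rfl⟩
      have := (hker i v).2 hv
      rwa [← mulVec_mulVec] at this
  set f : ℕ → ℝ := fun i => Real.log (Cᴴ * X i * C).det.re with hf
  have hstep : ∀ i, f (i + 1) - f i ≤ -∑ j, β i j * jump (K.map (E i).mulVecLin) j := by
    intro i
    have h1 := log_det_exp_le (hinj i) (hβ i)
    have h2 := sum_mul_jump_range_add_ker_le (hR i) (hβ i) (hβ0 i)
    rw [hrange] at h1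
    rw [hkerR] at h2
    have e0 : Cᴴ * X i * C = (R i * E i * C)ᴴ * (R i * E i * C) := by
      rw [hX0, conjTranspose_mul (R i * E i)]; simp only [Matrix.mul_assoc]
    have e1 : Cᴴ * X (i + 1) * C = (R i * E i * C)ᴴ *
        (diagonal fun j => ((Real.exp (β i j) : ℝ) : ℂ)) * (R i * E i * C) := by
      rw [hX1, conjTranspose_mul (R i * E i), expDiag]; simp only [Matrix.mul_assoc]
    simp only [hf, e0, e1]
    linarith
  have htotal : f n ≤ f 0 := by
    have h1 := Finset.sum_le_sum fun i (_ : i ∈ Finset.range n) => hstep i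
    rw [Finset.sum_range_sub, Finset.sum_neg_distrib] at h1
    have := hss K
    linarith
  have hpd : ∀ i, (Cᴴ * X i * C).PosDef := by
    intro i
    have e0 : Cᴴ * X i * C = (R i * E i * C)ᴴ * (R i * E i * C) := by
      rw [hX0, conjTranspose_mul (R i * E i)]; simp only [Matrix.mul_assoc]
    rw [e0]
    simpa using posDef_conjTranspose_mul_mul PosDef.one (hinj i)
  have hs0 : 0 < s := by linarith
  have hmono := log_det_mono ((hpd 0).smul hs0) (hpd n) fun v => by
    rw [qf_smul, qf_conj, qf_conj]
    exact hcon _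
  have hdet : (s • (Cᴴ * X 0 * C)).det.re = s ^ q * (Cᴴ * X 0 * C).det.re := by
    have : s • (Cᴴ * X 0 * C) = (s : ℂ) • (Cᴴ * X 0 * C) := by
      ext i j
      simp
    rw [this, det_smul, Fintype.card_fin, ← Complex.ofReal_pow, Complex.re_ofReal_mul]
  rw [hdet, Real.log_mul (by positivity) (det_re_pos (hpd 0)).ne', Real.log_pow] at hmono
  have : 0 < (q : ℝ) * Real.log s := mul_pos (by exact_mod_cast hq) (Real.log_pos hs)
  simp only [hf] at htotal
  linarith

end Degenerate

section Polygon

open scoped ComplexOrder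
open Filter Topology Module

variable {m : ℕ}

theorem posDef_add_smul_one {x : Matrix (Fin m) (Fin m) ℂ} (hx : x.PosSemidef) {d : ℝ}
    (hd : 0 < d) : (x + d • (1 : Matrix (Fin m) (Fin m) ℂ)).PosDef :=
  PosDef.posSemidef_add hx (PosDef.one.smul hd)

/-- A semistable configuration admits almost closed chains of positive definite steps. -/
theorem Semistable.exists_chain {n : ℕ} {E : ℕ → Matrix (Fin m) (Fin m) ℂ} {β : ℕ → Fin m → ℝ}
    (hss : Semistable n E β) (hE : ∀ i, IsUnit (E i).det) (hβ : ∀ i, Monotone (β i))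
    (hβ0 : ∀ i, ∑ j, β i j = 0) {s : ℝ} (hs : 1 < s) :
    ∃ z : ℕ → Matrix (Fin m) (Fin m) ℂ, (∀ i, (z i).PosDef) ∧
      (∀ i, Step (E i) (β i) (z i) (z (i + 1))) ∧ ∀ v, qf (z n) v ≤ s * qf (z 0) v := by
  have hex : ∀ i x, ∃ x', x.PosDef → Step (E i) (β i) x x' := fun i x => by
    by_cases hx : x.PosDef
    · obtain ⟨x', h⟩ := exists_step (hE i) (β i) hx
      exact ⟨x', fun _ => h⟩
    · exact ⟨0, fun h => absurd h hx⟩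
  choose φ hφ using hex
  let z : Matrix (Fin m) (Fin m) ℂ → ℕ → Matrix (Fin m) (Fin m) ℂ :=
    fun x k => Nat.rec x (fun i y => φ i y) k
  have hz0 : ∀ x, z x 0 = x := fun x => rfl
  have hzs : ∀ x k, z x (k + 1) = φ k (z x k) := fun x k => rfl
  have hzpd : ∀ x, x.PosDef → ∀ k, (z x k).PosDef := by
    intro x hx k
    induction k with
    | zero => exact hx
    | succ k ih => rw [hzs]; exact (hφ k _ ih).posDef ih
  have hzstep : ∀ x, x.PosDef → ∀ k, Step (E k) (β k) (z x k) (z x (k + 1)) := by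
    intro x hx k
    rw [hzs]
    exact hφ k _ (hzpd x hx k)
  have hmono : ∀ x y, x.PosDef → y.PosDef → ∀ c : ℝ, 0 < c → (∀ v, qf x v ≤ c * qf y v) →
      ∀ v, qf (z x n) v ≤ c * qf (z y n) v := by
    intro x y hx hy c _ h
    generalize n = k
    induction k with
    | zero => exact h
    | succ k ih => exact Step.mono (hβ k) (hzstep x hx k) (hzstep y hy k) (hzpd y hy k) ih
  obtain ⟨s₁, hs₁, hss₁⟩ := exists_between hs
  rcases exists_supersolution_or_subsolution (fun x => z x n) (fun x hx => hzpd x hx n) hmono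
    (lt_trans one_pos hs₁) with h | ⟨x, hx, hx0, h⟩
  · obtain ⟨x, hx, hle⟩ := h s hss₁
    exact ⟨z x, hzpd x hx, hzstep x hx, hle⟩
  · exfalso
    have hex : ∀ i y, ∃ y', y.PosSemidef → Step (E i) (β i) y y' ∧ ∀ η : ℝ, 0 < η →
        ∃ δ : ℝ, 0 < δ ∧ ∀ w, Step (E i) (β i) (y + δ • 1) w → ∀ v, qf w v ≤ qf (y' + η • 1) v :=
      fun i y => by
        by_cases hy : y.PosSemidef
        · obtain ⟨y', h⟩ := exists_step_limit (hE i) (hβ i) hy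
          exact ⟨y', fun _ => h⟩
        · exact ⟨0, fun h => absurd h hy⟩
    choose ψ hψ using hex
    let X : ℕ → Matrix (Fin m) (Fin m) ℂ := fun k => Nat.rec x (fun i y => ψ i y) k
    have hXs : ∀ k, X (k + 1) = ψ k (X k) := fun k => rfl
    have hXpsd : ∀ k, (X k).PosSemidef := by
      intro k
      induction k with
      | zero => exact hx
      | succ k ih => rw [hXs]; exact (hψ k _ ih).1.posSemidef
    have happrox : ∀ k, ∀ η : ℝ, 0 < η → ∃ δ : ℝ, 0 < δ ∧
        ∀ v, qf (z (x + δ • 1) k) v ≤ qf (X k + η • 1) v := by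
      intro k
      induction k with
      | zero => exact fun η hη => ⟨η, hη, fun v => le_rfl⟩
      | succ k ih =>
        intro η hη
        obtain ⟨δ', hδ', h1⟩ := (hψ k _ (hXpsd k)).2 η hη
        obtain ⟨δ, hδ, h2⟩ := ih δ' hδ'
        refine ⟨δ, hδ, fun v => ?_⟩
        have hpd := posDef_add_smul_one (hXpsd k) hδ'
        obtain ⟨w, hw⟩ := exists_step (hE k) (β k) hpd
        refine le_trans ?_ (h1 w hw v)
        have := Step.mono (hβ k) (hzstep _ (posDef_add_smul_one hx hδ) k) hw hpd (c := 1)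
          (fun v => by rw [one_mul]; exact h2 v) v
        rwa [one_mul] at this
    obtain ⟨v, hv⟩ := hss.exists_qf_lt hE hβ hβ0 (X := X)
      (fun i => (hψ i _ (hXpsd i)).1) hx0 hs₁
    have hle : ∀ η : ℝ, 0 < η → s₁ * qf x v ≤ qf (X n) v + η * ∑ j, ‖v j‖ ^ 2 := by
      intro η hη
      obtain ⟨δ, hδ, h2⟩ := happrox n η hη
      have := (h δ hδ v).trans (h2 v)
      rwa [qf_add, qf_smul, qf_one] at this
    have hlim : Tendsto (fun η : ℝ => qf (X n) v + η * ∑ j, ‖v j‖ ^ 2) (𝓝[>] 0)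
        (𝓝 (qf (X n) v)) := by
      have hc : Continuous fun η : ℝ => qf (X n) v + η * ∑ j, ‖v j‖ ^ 2 := by fun_prop
      have := hc.tendsto 0
      rw [zero_mul, add_zero] at this
      exact this.mono_left nhdsWithin_le_nhds
    exact absurd (ge_of_tendsto hlim (eventually_mem_nhdsWithin.mono fun η hη => hle η hη))
      (not_le.2 hv)

/-- The partial products `g 0 * ⋯ * g (k - 1)`. -/
def partialProd (g : ℕ → Matrix (Fin m) (Fin m) ℂ) : ℕ → Matrix (Fin m) (Fin m) ℂ
  | 0 => 1
  | k + 1 => partialProd g k * g k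

theorem partialProd_congr {g h : ℕ → Matrix (Fin m) (Fin m) ℂ} {k : ℕ} (H : ∀ i < k, g i = h i) :
    partialProd g k = partialProd h k := by
  induction k with
  | zero => rfl
  | succ k ih =>
    rw [partialProd, partialProd, ih fun i hi => H i (by omega), H k (by omega)]

theorem det_partialProd {g : ℕ → Matrix (Fin m) (Fin m) ℂ} (hg : ∀ i, (g i).det = 1) (k : ℕ) :
    (partialProd g k).det = 1 := by
  induction k with
  | zero => simp [partialProd]
  | succ k ih => rw [partialProd, det_mul, ih, hg, one_mul]

theorem tendsto_partialProd {ι : Type*} {l : Filter ι} {g : ι → ℕ → Matrix (Fin m) (Fin m) ℂ}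
    {G : ℕ → Matrix (Fin m) (Fin m) ℂ} (h : ∀ i, Tendsto (fun a => g a i) l (𝓝 (G i))) (k : ℕ) :
    Tendsto (fun a => partialProd (g a) k) l (𝓝 (partialProd G k)) := by
  induction k with
  | zero => exact tendsto_const_nhds
  | succ k ih => exact ih.mul (h k)

/-- The matrix `g` has singular values `exp (β j / 2)`, with left singular vectors the columns of
the unitary matrix `u`. -/
structure IsSide (β : Fin m → ℝ) (g u : Matrix (Fin m) (Fin m) ℂ) : Prop where
  det_eq_one : g.det = 1
  isometry : uᴴ * u = 1
  mul_conjTranspose : g * gᴴ = u * expDiag β * uᴴ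

theorem exists_posSemidef_sqrt {x : Matrix (Fin m) (Fin m) ℂ} (hx : x.PosSemidef) :
    ∃ y : Matrix (Fin m) (Fin m) ℂ, y.PosSemidef ∧ y * y = x := by
  open scoped MatrixOrder Matrix.Norms.L2Operator in
  exact ⟨CFC.sqrt x, Matrix.nonneg_iff_posSemidef.1 (CFC.sqrt_nonneg x),
    CFC.sqrt_mul_sqrt_self x hx.nonneg⟩

theorem det_eq_of_mul_self_det_eq {x y : Matrix (Fin m) (Fin m) ℂ} (hx : x.PosSemidef)
    (hy : y.PosSemidef) (h : (x * x).det = (y * y).det) : x.det = y.det := by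
  have hx0 := Complex.le_def.1 hx.det_nonneg
  have hy0 := Complex.le_def.1 hy.det_nonneg
  rw [det_mul, det_mul, ← ofReal_det_re hx.isHermitian, ← ofReal_det_re hy.isHermitian,
    ← Complex.ofReal_mul, ← Complex.ofReal_mul] at h
  rw [← ofReal_det_re hx.isHermitian, ← ofReal_det_re hy.isHermitian]
  rw [Complex.ofReal_inj] at h ⊢
  exact (mul_self_inj_of_nonneg hx0.1 hy0.1).1 h

theorem Semistable.exists_almost_closed {n : ℕ} {E : ℕ → Matrix (Fin m) (Fin m) ℂ}
    {β : ℕ → Fin m → ℝ} (hss : Semistable n E β) (hE : ∀ i, IsUnit (E i).det)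
    (hβ : ∀ i, Monotone (β i)) (hβ0 : ∀ i, ∑ j, β i j = 0) {s : ℝ} (hs : 1 < s) :
    ∃ g u : ℕ → Matrix (Fin m) (Fin m) ℂ, (∀ i, IsSide (β i) (g i) (u i)) ∧
      ∀ v, qf (partialProd g n * (partialProd g n)ᴴ) v ≤ s * ∑ j, ‖v j‖ ^ 2 := by
  obtain ⟨z, hz, hstep, hle⟩ := hss.exists_chain hE hβ hβ0 hs
  choose h hh hhz using fun i => exists_posSemidef_sqrt (hz i).posSemidef
  have hdet : ∀ i, (h (i + 1)).det = (h i).det := fun i =>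
    det_eq_of_mul_self_det_eq (hh _) (hh _) (by rw [hhz, hhz, (hstep i).det_eq (hβ0 i)])
  have hu : ∀ i, IsUnit (h i).det := fun i => by
    have := (isUnit_iff_isUnit_det _).1 (hz i).isUnit
    rw [← hhz, det_mul] at this
    exact isUnit_of_mul_isUnit_right this
  have hH : ∀ i, (h i)⁻¹ᴴ = (h i)⁻¹ := fun i => by
    rw [conjTranspose_nonsing_inv, (hh i).isHermitian.eq]
  choose R hR h0 h1 using hstep
  refine ⟨fun i => (h i)⁻¹ * h (i + 1), fun i => (h i)⁻¹ * (R i * E i)ᴴ, fun i => ⟨?_, ?_, ?_⟩,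
    fun v => ?_⟩
  · rw [det_mul, hdet, ← det_mul, nonsing_inv_mul _ (hu i), det_one]
  · rw [mul_eq_one_comm, conjTranspose_mul, conjTranspose_conjTranspose, hH, Matrix.mul_assoc,
      ← Matrix.mul_assoc (R i * E i)ᴴ, ← h0, ← hhz, mul_nonsing_inv_cancel_right _ _ (hu i),
      nonsing_inv_mul _ (hu i)]
  · rw [conjTranspose_mul, conjTranspose_mul, conjTranspose_conjTranspose, hH,
      (hh (i + 1)).isHermitian.eq]
    calc (h i)⁻¹ * h (i + 1) * (h (i + 1) * (h i)⁻¹)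
        = (h i)⁻¹ * (h (i + 1) * h (i + 1)) * (h i)⁻¹ := by simp only [Matrix.mul_assoc]
      _ = _ := by rw [hhz, h1]; simp only [Matrix.mul_assoc]
  · have hp : ∀ k, partialProd (fun i => (h i)⁻¹ * h (i + 1)) k = (h 0)⁻¹ * h k := by
      intro k
      induction k with
      | zero => rw [partialProd, nonsing_inv_mul _ (hu 0)]
      | succ k ih =>
        rw [partialProd, ih, Matrix.mul_assoc, mul_nonsing_inv_cancel_left _ _ (hu k)]
    have e : (h 0)⁻¹ * h n * ((h 0)⁻¹ * h n)ᴴ = (h 0)⁻¹ᴴ * z n * (h 0)⁻¹ := by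
      rw [conjTranspose_mul, hH, (hh n).isHermitian.eq, ← hhz]
      simp only [Matrix.mul_assoc]
    rw [hp, e, qf_conj]
    refine (hle _).trans (le_of_eq ?_)
    have e0 : (h 0)⁻¹ᴴ * z 0 * (h 0)⁻¹ = 1 := by
      rw [hH, ← hhz, Matrix.mul_assoc, mul_nonsing_inv_cancel_right _ _ (hu 0),
        nonsing_inv_mul _ (hu 0)]
    rw [← qf_conj, e0, qf_one]

end Polygon

section Limit

open scoped ComplexOrder
open Filter Topology

variable {m : ℕ}

theorem IsSide.trace_conjTranspose_mul_self {β : Fin m → ℝ} {g u : Matrix (Fin m) (Fin m) ℂ}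
    (h : IsSide β g u) : (gᴴ * g).trace.re = ∑ j, Real.exp (β j) := by
  rw [trace_mul_comm, h.mul_conjTranspose, Matrix.mul_assoc, trace_mul_comm, Matrix.mul_assoc,
    h.isometry, Matrix.mul_one, expDiag, trace_diagonal, ← Complex.ofReal_sum, Complex.ofReal_re]

theorem tendsto_expDiag {ι : Type*} {l : Filter ι} {β : ι → Fin m → ℝ} {b : Fin m → ℝ}
    (h : Tendsto β l (𝓝 b)) : Tendsto (fun a => expDiag (β a)) l (𝓝 (expDiag b)) := by
  have : Continuous (expDiag : (Fin m → ℝ) → _) := by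
    unfold expDiag
    exact Continuous.matrix_diagonal (by fun_prop)
  exact (this.tendsto b).comp h

theorem IsSide.of_tendsto {ι : Type*} {l : Filter ι} [l.NeBot] {β : ι → Fin m → ℝ}
    {g u : ι → Matrix (Fin m) (Fin m) ℂ} {b : Fin m → ℝ} {G V : Matrix (Fin m) (Fin m) ℂ}
    (h : ∀ a, IsSide (β a) (g a) (u a)) (hβ : Tendsto β l (𝓝 b)) (hg : Tendsto g l (𝓝 G))
    (hu : Tendsto u l (𝓝 V)) : IsSide b G V := by
  have hct : Continuous fun x : Matrix (Fin m) (Fin m) ℂ => xᴴ := continuous_id.matrix_conjTranspose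
  have hgs := (hct.tendsto G).comp hg
  have hus := (hct.tendsto V).comp hu
  refine ⟨?_, ?_, ?_⟩
  · refine tendsto_nhds_unique ((continuous_id.matrix_det.tendsto G).comp hg)
      (tendsto_const_nhds.congr fun a => ?_)
    exact (h a).det_eq_one.symm
  · exact tendsto_nhds_unique (hus.mul hu) (tendsto_const_nhds.congr fun a => (h a).isometry.symm)
  · exact tendsto_nhds_unique (hg.mul hgs)
      (((hu.mul (tendsto_expDiag hβ)).mul hus).congr fun a => (h a).mul_conjTranspose.symm)

theorem exists_tendsto_isSide {β : ℕ → ℕ → Fin m → ℝ} {g u : ℕ → ℕ → Matrix (Fin m) (Fin m) ℂ}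
    (h : ∀ N i, IsSide (β N i) (g N i) (u N i)) {c : ℕ → ℝ}
    (hc : ∀ N i, ∑ j, Real.exp (β N i j) ≤ c i) {b : ℕ → Fin m → ℝ}
    (hβ : ∀ i, Tendsto (fun N => β N i) atTop (𝓝 (b i))) :
    ∃ (G V : ℕ → Matrix (Fin m) (Fin m) ℂ) (φ : ℕ → ℕ), StrictMono φ ∧
      (∀ i, Tendsto (fun N => g (φ N) i) atTop (𝓝 (G i))) ∧
      (∀ i, Tendsto (fun N => u (φ N) i) atTop (𝓝 (V i))) ∧ ∀ i, IsSide (b i) (G i) (V i) := by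
  obtain ⟨G, φ, hφ, hG⟩ := exists_tendsto_family (T := g) (c := c) fun N i =>
    ((h N i).trace_conjTranspose_mul_self).le.trans (hc N i)
  obtain ⟨V, ψ, hψ, hV⟩ := exists_tendsto_family (T := fun N => u (φ N)) (c := fun _ => m)
    fun N i => by rw [(h _ i).isometry]; simp
  have hG' : ∀ i, Tendsto (fun N => g (φ (ψ N)) i) atTop (𝓝 (G i)) :=
    fun i => (hG i).comp hψ.tendsto_atTop
  exact ⟨G, V, φ ∘ ψ, hφ.comp hψ, hG', hV, fun i =>
    .of_tendsto (fun N => h (φ (ψ N)) i) ((hβ i).comp (hφ.comp hψ).tendsto_atTop) (hG' i) (hV i)⟩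

theorem mul_conjTranspose_eq_one_of_qf_le {P : Matrix (Fin m) (Fin m) ℂ} (hdet : P.det = 1)
    (h : ∀ v, qf (P * Pᴴ) v ≤ ∑ j, ‖v j‖ ^ 2) : P * Pᴴ = 1 := by
  have hpsd : (1 - P * Pᴴ).PosSemidef :=
    posSemidef_of_qf (isHermitian_one.sub (isHermitian_mul_conjTranspose_self P)) fun v => by
      rw [qf_sub, qf_one]; exact sub_nonneg.2 (h v)
  have hP : IsUnit P := (isUnit_iff_isUnit_det _).2 (by rw [hdet]; exact isUnit_one)
  have hpd : (P * Pᴴ).PosDef := by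
    have := posDef_conjTranspose_mul_mul (x := (1 : Matrix (Fin m) (Fin m) ℂ)) PosDef.one
      (B := Pᴴ) (mulVec_injective_of_isUnit ((isUnit_conjTranspose P).2 hP))
    simpa using this
  have hle := log_det_le_trace_sub hpd
  rw [det_mul, det_conjTranspose, hdet] at hle
  have htr := Complex.le_def.1 hpsd.trace_nonneg
  have h0 : (1 - P * Pᴴ).trace = 0 := by
    apply Complex.ext
    · apply le_antisymm _ htr.1
      simp [trace_sub] at hle ⊢
      exact hle
    · exact htr.2.symm
  exact (sub_eq_zero.1 (hpsd.trace_eq_zero_iff.1 h0)).symm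

/-- A semistable configuration with traceless weights is realized by a closed polygon. -/
theorem Semistable.exists_polygon {n : ℕ} {E : ℕ → Matrix (Fin m) (Fin m) ℂ}
    {β : ℕ → Fin m → ℝ} (hss : Semistable n E β) (hE : ∀ i, IsUnit (E i).det)
    (hβ : ∀ i, Monotone (β i)) (hβ0 : ∀ i, ∑ j, β i j = 0) (hn : 0 < n) :
    ∃ g u : ℕ → Matrix (Fin m) (Fin m) ℂ, (∀ i, IsSide (β i) (g i) (u i)) ∧
      partialProd g n = 1 := by
  choose g u hgu hle using fun N : ℕ => hss.exists_almost_closed hE hβ hβ0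
    (s := 1 + 1 / ((N : ℝ) + 1)) (by simp; positivity)
  obtain ⟨G, V, φ, hφ, hG, -, hside⟩ := exists_tendsto_isSide (β := fun _ => β) hgu
    (fun _ _ => le_rfl) fun _ => tendsto_const_nhds
  obtain ⟨k, rfl⟩ := Nat.exists_eq_succ_of_ne_zero hn.ne'
  have hdet := det_partialProd (fun i => (hside i).det_eq_one) (k + 1)
  have hP : partialProd G (k + 1) * (partialProd G (k + 1))ᴴ = 1 := by
    refine mul_conjTranspose_eq_one_of_qf_le hdet fun v => ?_
    have h1 := tendsto_partialProd hG (k + 1)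
    have hc : Continuous fun x : Matrix (Fin m) (Fin m) ℂ => qf (x * xᴴ) v :=
      (continuous_qf v).comp (continuous_id.mul continuous_id.matrix_conjTranspose)
    have h2 : Tendsto (fun N : ℕ => (1 + 1 / ((N : ℝ) + 1)) * ∑ j, ‖v j‖ ^ 2) atTop
        (𝓝 ((1 + 0) * ∑ j, ‖v j‖ ^ 2)) :=
      (tendsto_one_div_add_atTop_nhds_zero_nat.const_add 1).mul_const _
    rw [add_zero, one_mul] at h2
    exact le_of_tendsto_of_tendsto' ((hc.tendsto _).comp h1) (h2.comp hφ.tendsto_atTop)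
      fun N => hle (φ N) v
  set P := partialProd G (k + 1) with hPdef
  have hP' : Pᴴ * P = 1 := mul_eq_one_comm.1 hP
  refine ⟨Function.update G k (G k * Pᴴ), V, fun i => ?_, ?_⟩
  · obtain rfl | hi := eq_or_ne i k
    · rw [Function.update_self]
      refine ⟨?_, (hside i).isometry, ?_⟩
      · rw [det_mul, (hside i).det_eq_one, det_conjTranspose, hdet]; simp
      · rw [conjTranspose_mul, conjTranspose_conjTranspose, Matrix.mul_assoc,
          ← Matrix.mul_assoc Pᴴ, hP', Matrix.one_mul, (hside i).mul_conjTranspose]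
    · rw [Function.update_of_ne hi]; exact hside i
  · rw [partialProd, Function.update_self, partialProd_congr (h := G) fun i hi =>
      Function.update_of_ne hi.ne _ _, ← Matrix.mul_assoc]
    exact hP

theorem IsSide.mul_conjTranspose_sub {β : Fin m → ℝ} {g u : Matrix (Fin m) (Fin m) ℂ}
    (h : IsSide β g u) (p : Matrix (Fin m) (Fin m) ℂ) :
    p * g * (p * g)ᴴ - p * pᴴ = p * u * (expDiag β - 1) * (p * u)ᴴ := by
  have hu : u * uᴴ = 1 := mul_eq_one_comm.1 h.isometry
  calc p * g * (p * g)ᴴ - p * pᴴ = p * (g * gᴴ) * pᴴ - p * (u * uᴴ) * pᴴ := by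
        rw [hu, conjTranspose_mul, Matrix.mul_one]; simp only [Matrix.mul_assoc]
    _ = _ := by
      rw [h.mul_conjTranspose, conjTranspose_mul]
      simp only [Matrix.mul_assoc, Matrix.mul_sub, Matrix.sub_mul, Matrix.one_mul]

theorem tendsto_smul_expDiag_sub_one (γ : Fin m → ℝ) :
    Tendsto (fun N : ℕ => ((N : ℝ) + 1) • (expDiag ((1 / ((N : ℝ) + 1)) • γ) - 1)) atTop
      (𝓝 (diagonal fun j => (γ j : ℂ))) := by
  have hc : Continuous fun d : Fin m → ℝ => diagonal fun j => (d j : ℂ) :=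
    Continuous.matrix_diagonal (by fun_prop)
  have h := (hc.tendsto γ).comp
    (tendsto_pi_nhds.2 fun j => tendsto_mul_exp_sub_one (γ j))
  refine h.congr fun N => ?_
  rw [Function.comp_apply, expDiag, ← diagonal_one, diagonal_sub, ← diagonal_smul]
  congr 1
  funext j
  rw [Pi.smul_apply, Pi.smul_apply, smul_eq_mul, one_div_mul_eq_div, Complex.real_smul]
  push_cast
  rfl

/-- Closed polygons with side lengths tending to zero proportionally to `γ` yield a closed polygon
in the infinitesimal symmetric space. -/
theorem exists_sum_eq_zero_of_polygons {n : ℕ} {γ : ℕ → Fin m → ℝ}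
    (h : ∀ N : ℕ, ∃ g u : ℕ → Matrix (Fin m) (Fin m) ℂ,
      (∀ i, IsSide ((1 / ((N : ℝ) + 1)) • γ i) (g i) (u i)) ∧ partialProd g n = 1) :
    ∃ W : ℕ → Matrix (Fin m) (Fin m) ℂ, (∀ i, (W i)ᴴ * W i = 1) ∧
      ∑ i ∈ Finset.range n, W i * (diagonal fun j => (γ i j : ℂ)) * (W i)ᴴ = 0 := by
  choose g u hgu hprod using h
  have ht := tendsto_one_div_add_atTop_nhds_zero_nat (𝕜 := ℝ)
  obtain ⟨G, V, φ, hφ, hG, hV, hside⟩ := exists_tendsto_isSide hgu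
    (c := fun i => ∑ j, Real.exp |γ i j|) (b := 0)
    (fun N i => Finset.sum_le_sum fun j _ => Real.exp_le_exp.2 <| by
      rw [Pi.smul_apply, smul_eq_mul]
      refine (le_abs_self _).trans ?_
      rw [abs_mul, abs_of_nonneg (by positivity)]
      refine mul_le_of_le_one_left (abs_nonneg _) ?_
      rw [div_le_one (by positivity)]
      simp)
    (fun i => by simpa using ht.smul_const (γ i))
  have h0 : expDiag (0 : Fin m → ℝ) = 1 := by simp [expDiag]
  have hGG : ∀ i, G i * (G i)ᴴ = 1 := fun i => by
    rw [(hside i).mul_conjTranspose, Pi.zero_apply, h0, Matrix.mul_one,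
      mul_eq_one_comm.1 (hside i).isometry]
  have hp : ∀ k, partialProd G k * (partialProd G k)ᴴ = 1 := by
    intro k
    induction k with
    | zero => simp [partialProd]
    | succ k ih =>
      rw [partialProd, conjTranspose_mul, Matrix.mul_assoc, ← Matrix.mul_assoc (G k), hGG,
        Matrix.one_mul, ih]
  refine ⟨fun i => partialProd G i * V i, fun i => ?_, ?_⟩
  · rw [conjTranspose_mul, Matrix.mul_assoc, ← Matrix.mul_assoc (partialProd G i)ᴴ,
      mul_eq_one_comm.1 (hp i), Matrix.one_mul, (hside i).isometry]
  · have hct : Continuous fun x : Matrix (Fin m) (Fin m) ℂ => xᴴ :=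
      continuous_id.matrix_conjTranspose
    have hW : ∀ i, Tendsto (fun N => partialProd (g (φ N)) i * u (φ N) i) atTop
        (𝓝 (partialProd G i * V i)) := fun i => (tendsto_partialProd hG i).mul (hV i)
    have hlim := tendsto_finsetSum (Finset.range n) fun i _ =>
      ((hW i).mul ((tendsto_smul_expDiag_sub_one (γ i)).comp hφ.tendsto_atTop)).mul
        ((hct.tendsto _).comp (hW i))
    refine tendsto_nhds_unique hlim (tendsto_const_nhds.congr fun N => ?_)
    have hsum : ∑ i ∈ Finset.range n, ((φ N : ℝ) + 1) •
        (partialProd (g (φ N)) (i + 1) * (partialProd (g (φ N)) (i + 1))ᴴ -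
          partialProd (g (φ N)) i * (partialProd (g (φ N)) i)ᴴ) = 0 := by
      rw [← Finset.smul_sum, Finset.sum_range_sub fun i =>
        partialProd (g (φ N)) i * (partialProd (g (φ N)) i)ᴴ, hprod]
      simp [partialProd]
    rw [← hsum]
    refine Finset.sum_congr rfl fun i _ => ?_
    rw [partialProd, (hgu (φ N) i).mul_conjTranspose_sub]
    simp only [Function.comp_apply, Matrix.mul_smul, Matrix.smul_mul]

end Limit

section Spectrum

variable {m : ℕ}

theorem exists_perm_of_map_univ_eq {f g : Fin m → ℝ}
    (h : Multiset.map f Finset.univ.val = Multiset.map g Finset.univ.val) :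
    ∃ σ : Equiv.Perm (Fin m), ∀ j, f j = g (σ j) := by
  have hp : (List.ofFn f).Perm (List.ofFn g) := by
    rwa [Fin.univ_val_map, Fin.univ_val_map, Multiset.coe_eq_coe] at h
  have he : f ∘ Tuple.sort f = g ∘ Tuple.sort g := List.ofFn_injective <|
    (((Tuple.sort f).ofFn_comp_perm f).trans
      (hp.trans ((Tuple.sort g).ofFn_comp_perm g).symm)).eq_of_pairwise'
      (Tuple.monotone_sort f).sortedLE_ofFn.pairwise
      (Tuple.monotone_sort g).sortedLE_ofFn.pairwise
  refine ⟨(Tuple.sort f).symm.trans (Tuple.sort g), fun j => ?_⟩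
  have := congrFun he ((Tuple.sort f).symm j)
  simpa using this

/-- A matrix is Hermitian with spectrum `d` if and only if it is unitarily equivalent to the
diagonal matrix with entries `d`. -/
theorem exists_eigenvalues_eq_iff {A : Matrix (Fin m) (Fin m) ℂ} {d : Fin m → ℝ} :
    (∃ h : A.IsHermitian, ∃ σ : Equiv.Perm (Fin m), ∀ j, h.eigenvalues j = d (σ j)) ↔
      ∃ U : Matrix (Fin m) (Fin m) ℂ, Uᴴ * U = 1 ∧
        A = U * (diagonal fun j => (d j : ℂ)) * Uᴴ := by
  constructor
  · rintro ⟨h, σ, hσ⟩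
    set V : Matrix (Fin m) (Fin m) ℂ := h.eigenvectorUnitary.1 with hV
    have hVV : Vᴴ * V = 1 := mem_unitaryGroup_iff'.1 h.eigenvectorUnitary.2
    have hA : A = V * (diagonal fun j => ((d (σ j) : ℝ) : ℂ)) * Vᴴ := by
      have := h.spectral_theorem
      rw [Unitary.conjStarAlgAut_apply] at this
      refine this.trans ?_
      congr 3
      funext j
      exact congrArg _ (hσ j)
    refine ⟨V.submatrix id σ.symm, ?_, ?_⟩
    · rw [conjTranspose_submatrix, ← submatrix_mul _ _ _ id _ Function.bijective_id, hVV,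
        submatrix_one_equiv]
    · have hd : (diagonal fun j => (d j : ℂ)) =
          (diagonal fun j => ((d (σ j) : ℝ) : ℂ)).submatrix σ.symm σ.symm := by
        rw [submatrix_diagonal_equiv]
        congr 1
        funext j
        simp
      rw [hd, conjTranspose_submatrix, submatrix_mul_equiv, submatrix_mul_equiv, ← hA,
        submatrix_id_id]
  · rintro ⟨U, hU, rfl⟩
    have h : (U * (diagonal fun j => (d j : ℂ)) * Uᴴ).IsHermitian :=
      isHermitian_mul_mul_conjTranspose U
        (isHermitian_diagonal_of_self_adjoint _ (by ext j; simp))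
    refine ⟨h, exists_perm_of_map_univ_eq ?_⟩
    have hr : (U * (diagonal fun j => (d j : ℂ)) * Uᴴ).charpoly.roots =
        Multiset.map (fun j => (d j : ℂ)) Finset.univ.val := by
      rw [Matrix.mul_assoc, charpoly_mul_comm, Matrix.mul_assoc, hU, Matrix.mul_one,
        charpoly_diagonal, Polynomial.roots_prod _ _
          (by simp [Finset.prod_ne_zero_iff, Polynomial.X_sub_C_ne_zero])]
      simp only [Polynomial.roots_X_sub_C, Multiset.bind_singleton]
    have := congrArg (Multiset.map Complex.re) (hr.symm.trans h.roots_charpoly_eq_eigenvalues)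
    simpa [Multiset.map_map, Function.comp_def] using this.symm

theorem prod_ofFn_eq_partialProd (g : ℕ → Matrix (Fin m) (Fin m) ℂ) (n : ℕ) :
    (List.ofFn fun i : Fin n => g i).prod = partialProd g n := by
  induction n with
  | zero => simp [partialProd]
  | succ n ih =>
    rw [List.ofFn_succ', List.concat_eq_append, List.prod_append, List.prod_singleton]
    exact congrArg (· * g n) ih

/-- The spectra of Hermitian matrices with zero sum and the (doubled) logarithmic singular values
of matrices of determinant one with trivial product agree. -/
theorem exists_sum_eq_zero_iff_exists_polygon {n : ℕ} (hn : 0 < n) {β : ℕ → Fin m → ℝ}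
    (hβ : ∀ i, Monotone (β i)) (hβ0 : ∀ i, ∑ j, β i j = 0) :
    (∃ U : ℕ → Matrix (Fin m) (Fin m) ℂ, (∀ i, (U i)ᴴ * U i = 1) ∧
      ∑ i ∈ Finset.range n, U i * (diagonal fun j => (β i j : ℂ)) * (U i)ᴴ = 0) ↔
    ∃ g u : ℕ → Matrix (Fin m) (Fin m) ℂ, (∀ i, IsSide ((2 : ℝ) • β i) (g i) (u i)) ∧
      partialProd g n = 1 := by
  have hmono : ∀ t : ℝ, 0 ≤ t → ∀ i, Monotone (t • β i) := fun t ht i _ _ hjk =>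
    mul_le_mul_of_nonneg_left (hβ i hjk) ht
  have hsum : ∀ t : ℝ, ∀ i, ∑ j, (t • β i) j = 0 := fun t i => by
    simp [← Finset.mul_sum, hβ0]
  have hunit : ∀ U : Matrix (Fin m) (Fin m) ℂ, Uᴴ * U = 1 → IsUnit U.det := fun U hU =>
    (isUnit_iff_isUnit_det _).1 (IsUnit.of_mul_eq_one_right _ hU)
  constructor
  · rintro ⟨U, hU, h⟩
    exact ((semistable_of_sum_eq_zero hβ hU h).smul (t := 2) zero_le_two).exists_polygon
      (fun i => by rw [det_conjTranspose]; exact (hunit _ (hU i)).star)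
      (hmono 2 zero_le_two) (hsum 2) hn
  · rintro ⟨g, u, hgu, hg⟩
    have hss := semistable_of_prod (hmono 2 zero_le_two) (fun i => (hgu i).isometry)
      (fun i => by rw [(hgu i).det_eq_one]; exact isUnit_one)
      (fun i => (hgu i).mul_conjTranspose) (h := partialProd g) rfl (fun _ => rfl) hg
    have hE : ∀ i, IsUnit ((partialProd g i * u i)ᴴ).det := fun i => by
      rw [det_conjTranspose, det_mul, det_partialProd (fun i => (hgu i).det_eq_one), one_mul]
      exact (hunit _ (hgu i).isometry).star
    refine exists_sum_eq_zero_of_polygons fun N => ?_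
    have ht : (0 : ℝ) ≤ 1 / ((N : ℝ) + 1) := by positivity
    have hss' := (hss.smul (t := 1 / 2) (by norm_num)).smul ht
    have he : ((1 / ((N : ℝ) + 1)) • (1 / 2 : ℝ) • fun i => (2 : ℝ) • β i) =
        fun i => (1 / ((N : ℝ) + 1)) • β i := by
      funext i j
      simp
    rw [he] at hss'
    exact hss'.exists_polygon hE (hmono _ ht) (hsum _) hn

end Spectrum

end Thompson

/-- Generalized Thompson conjecture for `SL(m, ℂ)`: a tuple of decreasing
trace-free spectra is realized by traceless Hermitian matrices summing to zero
iff it is realized (after exponentiating twice the entries) by the spectra of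
`gᵢ·gᵢᴴ` for matrices `gᵢ ∈ SL(m, ℂ)` with product `1`. -/
theorem thompson_conjecture_SL
    (m n : ℕ) (hm : 1 ≤ m) (hn : 3 ≤ n)
    (α : Fin n → Fin m → ℝ)
    (hdec : ∀ i, Antitone (α i))
    (hsum : ∀ i, ∑ j, α i j = 0) :
    (∃ A : Fin n → Matrix (Fin m) (Fin m) ℂ,
        (∑ i, A i) = 0 ∧
        ∀ i, ∃ h : (A i).IsHermitian,
          (A i).trace = 0 ∧
          ∃ σ : Equiv.Perm (Fin m), ∀ j, h.eigenvalues j = α i (σ j)) ↔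
    (∃ g : Fin n → Matrix (Fin m) (Fin m) ℂ,
        (List.ofFn g).prod = 1 ∧
        ∀ i, (g i).det = 1 ∧
          ∃ h : (g i * (g i)ᴴ).IsHermitian,
          ∃ σ : Equiv.Perm (Fin m), ∀ j, h.eigenvalues j = Real.exp (2 * α i (σ j))) := by
  have hrev : ∀ (A : Matrix (Fin m) (Fin m) ℂ) (f d : Fin m → ℝ), (∀ j, f j = d j.rev) →
      ((∃ h : A.IsHermitian, ∃ σ : Equiv.Perm (Fin m), ∀ j, h.eigenvalues j = d (σ j)) ↔
        ∃ U : Matrix (Fin m) (Fin m) ℂ, Uᴴ * U = 1 ∧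
          A = U * (diagonal fun j => (f j : ℂ)) * Uᴴ) := by
    intro A f d hfd
    rw [← Thompson.exists_eigenvalues_eq_iff]
    refine exists_congr fun h => ⟨?_, ?_⟩
    · rintro ⟨σ, hσ⟩
      exact ⟨σ.trans Fin.revPerm, fun j => by rw [hσ, hfd]; simp⟩
    · rintro ⟨σ, hσ⟩
      exact ⟨σ.trans Fin.revPerm, fun j => by rw [hσ, hfd]; simp⟩
  let β : ℕ → Fin m → ℝ := fun i => if h : i < n then α ⟨i, h⟩ ∘ Fin.rev else 0
  have hβα : ∀ (i : Fin n) j, β i j = α i j.rev := fun i j => by simp [β]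
  have hβ : ∀ i, Monotone (β i) := by
    intro i
    by_cases h : i < n
    · simp only [β, dif_pos h]
      exact (hdec _).comp Fin.rev_anti
    · simp only [β, dif_neg h]
      exact monotone_const
  have hβ0 : ∀ i, ∑ j, β i j = 0 := by
    intro i
    by_cases h : i < n
    · simp only [β, dif_pos h, Function.comp_apply]
      exact (Equiv.sum_comp Fin.revPerm (α ⟨i, h⟩)).trans (hsum _)
    · simp [β, h]
  have key := Thompson.exists_sum_eq_zero_iff_exists_polygon (n := n) (by omega) hβ hβ0
  constructor
  · rintro ⟨A, hA, h⟩
    choose U hU hAU using fun i => (hrev (A i) (β i) (α i) (hβα i)).1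
      ((h i).imp fun _ h => h.2)
    obtain ⟨g, u, hgu, hg⟩ := key.1 ⟨fun i => if h : i < n then U ⟨i, h⟩ else 1, fun i => by
      by_cases h : i < n <;> simp [h, hU], by
        rw [Finset.sum_range, ← hA]
        exact Finset.sum_congr rfl fun i _ => by simp [hAU i]⟩
    refine ⟨fun i => g i, by rw [Thompson.prod_ofFn_eq_partialProd, hg], fun i =>
      ⟨(hgu i).det_eq_one, ?_⟩⟩
    exact (hrev _ (fun j => Real.exp (2 * β i j)) (fun j => Real.exp (2 * α i j))
      fun j => by rw [hβα]).2 ⟨u i, (hgu i).isometry, (hgu i).mul_conjTranspose⟩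
  · rintro ⟨g, hg, h⟩
    choose u hu hgu using fun i : Fin n => (hrev _ (fun j => Real.exp (2 * β i j))
      (fun j => Real.exp (2 * α i j)) fun j => by rw [hβα]).1 (h i).2
    obtain ⟨U, hU, hsum0⟩ := key.2 ⟨fun i => if h : i < n then g ⟨i, h⟩ else 1,
      fun i => if h : i < n then u ⟨i, h⟩ else 1, fun i => by
        by_cases hi : i < n
        · simp only [dif_pos hi]
          exact ⟨(h _).1, hu _, hgu ⟨i, hi⟩⟩
        · simp only [dif_neg hi]
          exact ⟨det_one, by simp, by simp [β, hi, Thompson.expDiag]⟩, by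
        rw [← Thompson.prod_ofFn_eq_partialProd, ← hg]
        simp⟩
    rw [Finset.sum_range] at hsum0
    refine ⟨_, hsum0, fun i => ?_⟩
    obtain ⟨hH, hσ⟩ := (hrev _ (β i) (α i) (hβα i)).2 ⟨U i, hU i, rfl⟩
    refine ⟨hH, ?_, hσ⟩
    rw [Matrix.mul_assoc, trace_mul_comm, Matrix.mul_assoc, hU, Matrix.mul_one, trace_diagonal,
      ← Complex.ofReal_sum, hβ0, Complex.ofReal_zero]
end

section
/- Eigenvalues-of-a-sum problem for 3×3 Hermitian matrices (root system A₂), arbitrary number of summands: Let n ≥ 3 and for each i ∈ {1,…,n} let (aᵢ, bᵢ, cᵢ) ∈ ℝ³ satisfy aᵢ ≥ bᵢ ≥ cᵢ and aᵢ + bᵢ + cᵢ = 0. Then there exist traceless Hermitian 3×3 complex matrices A₁, …, Aₙ with A₁ + … + Aₙ = 0 such that for each i the multiset of eigenvalues of Aᵢ is {aᵢ, bᵢ, cᵢ}, if and only if the following inequalities hold: (I) for every i: aᵢ + Σ_{j≠i} cⱼ ≤ 0; (II) for every pair i ≠ j: bᵢ + bⱼ + Σ_{k∉{i,j}} c_k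 ≤ 0; (III) for every i: cᵢ + Σ_{j≠i} aⱼ ≥ 0; (IV) for every pair i ≠ j: bᵢ + bⱼ + Σ_{k∉{i,j}} a_k ≥ 0. -/
open Matrix Finset

/-- A quadratic system in `r` and `w`, multiplied by `r + w`, is solvable when its parameters
interlace strictly. -/
lemma exists_root_of_lt {h g k m f l : ℝ} (h0 : 0 < h) (hg : h < g) (gk : g < k)
    (m0 : 0 < m) (mf : m < f) (fl : f < l) :
    ∃ r ∈ Set.Icc h g, ∃ w ∈ Set.Icc m f,
      (k - r) * (r - h) * (r + w) = (g - r) * r * (r + f) ∧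
      (l - w) * (w - m) * (r + w) = (g + w) * w * (f - w) := by
  obtain ⟨r₀, hr₀, hr₀g, hu⟩ : ∃ r₀, h < r₀ ∧ r₀ < g ∧
      (k - r₀) * (r₀ - h) * (r₀ + f) < (g - r₀) * r₀ * (r₀ + f) := by
    have hc : Continuous fun r : ℝ => (g - r) * r * (r + f) - (k - r) * (r - h) * (r + f) := by
      fun_prop
    have hp : 0 < (g - h) * h * (h + f) - (k - h) * (h - h) * (h + f) := by
      have : 0 < (g - h) * h * (h + f) := by
        have := sub_pos.2 hg
        have : 0 < h + f := by linarith
        positivity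
      linarith
    have h1 := (hc.tendsto h).eventually (lt_mem_nhds hp)
    have h2 : ∀ᶠ r in nhdsWithin h (Set.Ioi h), h < r ∧ r < g := Ioo_mem_nhdsGT hg
    obtain ⟨r, hr, hr'⟩ := ((h1.filter_mono nhdsWithin_le_nhds).and h2).exists
    exact ⟨r, hr'.1, hr'.2, by linarith⟩
  set ω : ℝ → ℝ := fun r => (g - r) * r * (r + f) / ((k - r) * (r - h)) - r with hω
  set κ : ℝ → ℝ := fun r => max m (min f (ω r)) with hκ
  set V : ℝ → ℝ := fun r =>
    (l - κ r) * (κ r - m) * (r + κ r) - (g + κ r) * κ r * (f - κ r) with hV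
  have hden : ∀ r ∈ Set.Icc r₀ g, 0 < (k - r) * (r - h) := fun r hr =>
    mul_pos (by linarith [hr.2]) (by linarith [hr.1])
  have hωc : ContinuousOn ω (Set.Icc r₀ g) :=
    (ContinuousOn.div (by fun_prop) (by fun_prop) fun r hr => (hden r hr).ne').sub (by fun_prop)
  have hκc : ContinuousOn κ (Set.Icc r₀ g) :=
    (continuous_const.max (continuous_const.min continuous_id)).comp_continuousOn hωc
  have hVc : ContinuousOn V (Set.Icc r₀ g) := by fun_prop
  have hVf : ∀ r ∈ Set.Icc r₀ g, κ r = f → 0 < V r := by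
    intro r hr e
    have : 0 < (l - f) * (f - m) * (r + f) :=
      mul_pos (mul_pos (by linarith) (by linarith)) (by linarith [hr.1])
    simp only [hV, e]
    linarith
  have hVm : ∀ r ∈ Set.Icc r₀ g, κ r = m → V r < 0 := by
    intro r hr e
    have : 0 < (g + m) * m * (f - m) :=
      mul_pos (mul_pos (by linarith) m0) (by linarith)
    simp only [hV, e]
    linarith
  have hl : r₀ ∈ Set.Icc r₀ g := ⟨le_rfl, hr₀g.le⟩
  have hr : g ∈ Set.Icc r₀ g := ⟨hr₀g.le, le_rfl⟩
  have hωl : f ≤ ω r₀ := by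
    have := (lt_div_iff₀ (hden r₀ hl)).2 (by linarith :
      (r₀ + f) * ((k - r₀) * (r₀ - h)) < (g - r₀) * r₀ * (r₀ + f))
    simp only [hω]
    linarith
  have hωr : ω g ≤ m := by
    simp only [hω, sub_self, zero_mul, zero_div]
    linarith
  have hκl : κ r₀ = f := by simp only [hκ, min_eq_left hωl, max_eq_right mf.le]
  have hκr : κ g = m := max_eq_left ((min_le_right _ _).trans hωr)
  obtain ⟨r, hrm, hr0⟩ := intermediate_value_Icc' hr₀g.le hVc
    ⟨(hVm g hr hκr).le, (hVf r₀ hl hκl).le⟩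
  have hne_f : κ r ≠ f := fun e => (hVf r hrm e).ne' hr0
  have hne_m : κ r ≠ m := fun e => (hVm r hrm e).ne hr0
  have hκω : κ r = ω r := by
    rcases max_choice m (min f (ω r)) with e | e
    · exact absurd e hne_m
    · rcases min_choice f (ω r) with e' | e'
      · exact absurd (e.trans e') hne_f
      · exact e.trans e'
  refine ⟨r, ⟨hr₀.le.trans hrm.1, hrm.2⟩, κ r,
    ⟨le_max_left _ _, max_le mf.le (min_le_left _ _)⟩, ?_, sub_eq_zero.1 hr0⟩
  have hd := (hden r hrm).ne'
  have hkr := (mul_ne_zero_iff.1 hd).1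
  have hrh := (mul_ne_zero_iff.1 hd).2
  rw [hκω]
  simp only [hω]
  field_simp
  ring

/-- The same system after removing the spurious factor `r + w`; it is solvable on the closed
parameter region. -/
lemma exists_root_of_le {h g k m f l : ℝ} (h0 : 0 ≤ h) (hg : h ≤ g) (gk : g ≤ k)
    (m0 : 0 ≤ m) (mf : m ≤ f) (fl : f ≤ l) :
    ∃ r ∈ Set.Icc h g, ∃ w ∈ Set.Icc m f,
      (k + h - g + f) * r + (l + m - f + g) * w - r * w - h * k - l * m - g * f = 0 ∧
      h * k * w - l * m * r + (g - f - k - h + l + m) * (r * w) = 0 := by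
  have key : ∀ n : ℕ, ∃ z : ℝ × ℝ, z ∈ Set.Icc (0 : ℝ) (g + 2) ×ˢ Set.Icc (0 : ℝ) (f + 2) ∧
      ∃ ε : ℝ, ε = 1 / ((n : ℝ) + 1) ∧ z.1 ∈ Set.Icc (h + ε) (g + 2 * ε) ∧
        z.2 ∈ Set.Icc (m + ε) (f + 2 * ε) ∧
      ((k + 3 * ε) + (h + ε) - (g + 2 * ε) + (f + 2 * ε)) * z.1
        + ((l + 3 * ε) + (m + ε) - (f + 2 * ε) + (g + 2 * ε)) * z.2 - z.1 * z.2
        - (h + ε) * (k + 3 * ε) - (l + 3 * ε) * (m + ε) - (g + 2 * ε) * (f + 2 * ε) = 0 ∧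
      (h + ε) * (k + 3 * ε) * z.2 - (l + 3 * ε) * (m + ε) * z.1
        + ((g + 2 * ε) - (f + 2 * ε) - (k + 3 * ε) - (h + ε) + (l + 3 * ε) + (m + ε))
          * (z.1 * z.2) = 0 := by
    intro n
    have hε : 0 < 1 / ((n : ℝ) + 1) := by positivity
    have hε1 : 1 / ((n : ℝ) + 1) ≤ 1 := by
      rw [div_le_one (by positivity)]
      linarith [(Nat.cast_nonneg n : (0 : ℝ) ≤ n)]
    generalize 1 / ((n : ℝ) + 1) = ε at hε hε1
    obtain ⟨r, hr, w, hw, hu, hv⟩ := exists_root_of_lt (h := h + ε) (g := g + 2 * ε)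
      (k := k + 3 * ε) (m := m + ε) (f := f + 2 * ε) (l := l + 3 * ε) (by linarith)
      (by linarith) (by linarith) (by linarith) (by linarith) (by linarith)
    have hE : ((k + 3 * ε) + (h + ε) - (g + 2 * ε) + (f + 2 * ε)) * r
        + ((l + 3 * ε) + (m + ε) - (f + 2 * ε) + (g + 2 * ε)) * w - r * w
        - (h + ε) * (k + 3 * ε) - (l + 3 * ε) * (m + ε) - (g + 2 * ε) * (f + 2 * ε) = 0 := by
      have hne : r + w ≠ 0 := by
        have := hr.1
        have := hw.1
        linarith
      refine (mul_eq_zero.1 ?_).resolve_left hne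
      linear_combination hu + hv
    refine ⟨(r, w), ⟨⟨by linarith [hr.1], by linarith [hr.2]⟩,
      ⟨by linarith [hw.1], by linarith [hw.2]⟩⟩, ε, rfl, hr, hw, hE, ?_⟩
    linear_combination r * hE - hu
  choose z hz ε hε hr hw h1 h2 using key
  obtain ⟨y, -, φ, hφ, hy⟩ := (isCompact_Icc.prod isCompact_Icc).tendsto_subseq hz
  have hεt : Filter.Tendsto (fun n => ε (φ n)) Filter.atTop (nhds 0) := by
    rw [show ε = fun n : ℕ => 1 / ((n : ℝ) + 1) from funext hε]
    exact tendsto_one_div_add_atTop_nhds_zero_nat.comp hφ.tendsto_atTop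
  have ht : Filter.Tendsto (fun n => (ε (φ n), z (φ n))) Filter.atTop (nhds (0, y)) :=
    hεt.prodMk_nhds hy
  have closed : ∀ s : Set (ℝ × ℝ × ℝ), IsClosed s → (∀ n, (ε n, z n) ∈ s) → (0, y) ∈ s :=
    fun s hs hn => hs.mem_of_tendsto ht (Filter.Eventually.of_forall fun n => hn _)
  refine ⟨y.1, ⟨?_, ?_⟩, y.2, ⟨?_, ?_⟩, ?_, ?_⟩
  · simpa using closed {x | h + x.1 ≤ x.2.1} (isClosed_le (by fun_prop) (by fun_prop))
      fun n => (hr n).1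
  · simpa using closed {x | x.2.1 ≤ g + 2 * x.1} (isClosed_le (by fun_prop) (by fun_prop))
      fun n => (hr n).2
  · simpa using closed {x | m + x.1 ≤ x.2.2} (isClosed_le (by fun_prop) (by fun_prop))
      fun n => (hw n).1
  · simpa using closed {x | x.2.2 ≤ f + 2 * x.1} (isClosed_le (by fun_prop) (by fun_prop))
      fun n => (hw n).2
  · simpa using closed {x | ((k + 3 * x.1) + (h + x.1) - (g + 2 * x.1) + (f + 2 * x.1)) * x.2.1
        + ((l + 3 * x.1) + (m + x.1) - (f + 2 * x.1) + (g + 2 * x.1)) * x.2.2 - x.2.1 * x.2.2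
        - (h + x.1) * (k + 3 * x.1) - (l + 3 * x.1) * (m + x.1)
        - (g + 2 * x.1) * (f + 2 * x.1) = 0}
      (isClosed_eq (by fun_prop) (by fun_prop)) fun n => h1 n
  · simpa using closed {x | (h + x.1) * (k + 3 * x.1) * x.2.2
        - (l + 3 * x.1) * (m + x.1) * x.2.1
        + ((g + 2 * x.1) - (f + 2 * x.1) - (k + 3 * x.1) - (h + x.1) + (l + 3 * x.1)
          + (m + x.1)) * (x.2.1 * x.2.2) = 0}
      (isClosed_eq (by fun_prop) (by fun_prop)) fun n => h2 n

/-- `A` is a Hermitian `3×3` matrix with eigenvalues `a`, `b`, `c`, counted with multiplicity. -/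
def HasSpec (A : Matrix (Fin 3) (Fin 3) ℂ) (a b c : ℝ) : Prop :=
  A.IsHermitian ∧ ∀ z : ℂ, (scalar (Fin 3) z - A).det = (z - a) * (z - b) * (z - c)

lemma HasSpec.neg {A : Matrix (Fin 3) (Fin 3) ℂ} {a b c : ℝ} (h : HasSpec A a b c) :
    HasSpec (-A) (-c) (-b) (-a) := by
  refine ⟨h.1.neg, fun z => ?_⟩
  have e : scalar (Fin 3) z - -A = -(scalar (Fin 3) (-z) - A) := by
    rw [map_neg]
    abel
  rw [e, det_neg, h.2]
  simp only [Fintype.card_fin]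
  push_cast
  ring

lemma exists_triple_of_cyclic {a₁ b₁ c₁ a₂ b₂ c₂ a₃ b₃ c₃ : ℝ}
    (hs₁ : a₁ + b₁ + c₁ = 0) (hs₂ : a₂ + b₂ + c₂ = 0) (hs₃ : a₃ + b₃ + c₃ = 0)
    (hbab : 0 ≤ b₁ + a₂ + b₃) (hbac : b₁ + a₂ + c₃ ≤ 0) (haac : 0 ≤ a₁ + a₂ + c₃)
    (hcbb : c₁ + b₂ + b₃ ≤ 0) (hcba : 0 ≤ c₁ + b₂ + a₃) (hcca : c₁ + c₂ + a₃ ≤ 0) :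
    ∃ A₁ A₂ A₃, HasSpec A₁ a₁ b₁ c₁ ∧ HasSpec A₂ a₂ b₂ c₂ ∧ HasSpec A₃ a₃ b₃ c₃ ∧
      A₁ + A₂ + A₃ = 0 := by
  obtain ⟨r, hr, w, hw, h1, h2⟩ := exists_root_of_le (h := b₁ + a₂ + b₃) (g := b₃ - c₃)
    (k := a₁ + a₂ + b₃) (m := -(c₁ + b₂ + b₃)) (f := a₃ - b₃) (l := -(c₁ + c₂ + b₃))
    hbab (by linarith) (by linarith) (by linarith) (by linarith) (by linarith)
  obtain ⟨x, hx⟩ : ∃ x : ℝ, x * x = (a₁ + a₂ + b₃ - r) * (r - (b₁ + a₂ + b₃)) :=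
    ⟨_, Real.mul_self_sqrt (mul_nonneg (by linarith [hr.2]) (by linarith [hr.1]))⟩
  obtain ⟨y, hy⟩ : ∃ y : ℝ, y * y = (-(c₁ + c₂ + b₃) - w) * (w + (c₁ + b₂ + b₃)) :=
    ⟨_, Real.mul_self_sqrt (mul_nonneg (by linarith [hw.2]) (by linarith [hw.1]))⟩
  obtain rfl : c₁ = -(a₁ + b₁) := by linarith
  obtain rfl : c₂ = -(a₂ + b₂) := by linarith
  obtain rfl : c₃ = -(a₃ + b₃) := by linarith
  have h1' := congrArg (fun t : ℝ => (t : ℂ)) h1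
  have h2' := congrArg (fun t : ℝ => (t : ℂ)) h2
  have hx' := congrArg (fun t : ℝ => (t : ℂ)) hx
  have hy' := congrArg (fun t : ℝ => (t : ℂ)) hy
  push_cast at h1' h2' hx' hy'
  set p : ℝ := r - b₃ - a₂ with hp
  set q : ℝ := a₁ + b₁ - b₃ - w with hq
  set A : Matrix (Fin 3) (Fin 3) ℂ :=
    !![(p : ℂ), 0, x; 0, -(a₁ + b₁), 0; x, 0, a₁ + b₁ - p] with hA
  set B : Matrix (Fin 3) (Fin 3) ℂ :=
    !![(a₂ : ℂ), 0, 0; 0, q, y; 0, y, -a₂ - q] with hB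
  have hAh : A.IsHermitian := by
    ext i j
    fin_cases i <;> fin_cases j <;> simp [hA, conjTranspose_apply, Complex.conj_ofReal]
  have hBh : B.IsHermitian := by
    ext i j
    fin_cases i <;> fin_cases j <;> simp [hB, conjTranspose_apply, Complex.conj_ofReal]
  refine ⟨A, B, -(A + B), ⟨hAh, fun z => ?_⟩, ⟨hBh, fun z => ?_⟩,
    ⟨(hAh.add hBh).neg, fun z => ?_⟩, by abel⟩
  · simp [hA, det_fin_three, hp]
    linear_combination (-(z + (a₁ + b₁))) * hx'
  · simp [hB, det_fin_three, hq]
    linear_combination (-(z - a₂)) * hy'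
  · simp [hA, hB, det_fin_three, hp, hq]
    linear_combination (-(z - b₃ - w)) * hx' - (z + r - b₃) * hy' - (z - b₃) * h1' - h2'

/-- The Horn inequalities suffice for three summands. -/
lemma exists_triple {a₁ b₁ c₁ a₂ b₂ c₂ a₃ b₃ c₃ : ℝ}
    (hs₁ : a₁ + b₁ + c₁ = 0) (hs₂ : a₂ + b₂ + c₂ = 0) (hs₃ : a₃ + b₃ + c₃ = 0)
    (haac : 0 ≤ a₁ + a₂ + c₃) (haca : 0 ≤ a₁ + c₂ + a₃) (hcaa : 0 ≤ c₁ + a₂ + a₃)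
    (hbba : 0 ≤ b₁ + b₂ + a₃) (hbab : 0 ≤ b₁ + a₂ + b₃) (habb : 0 ≤ a₁ + b₂ + b₃)
    (hcca : c₁ + c₂ + a₃ ≤ 0) (hcac : c₁ + a₂ + c₃ ≤ 0) (hacc : a₁ + c₂ + c₃ ≤ 0)
    (hbbc : b₁ + b₂ + c₃ ≤ 0) (hbcb : b₁ + c₂ + b₃ ≤ 0) (hcbb : c₁ + b₂ + b₃ ≤ 0) :
    ∃ A₁ A₂ A₃, HasSpec A₁ a₁ b₁ c₁ ∧ HasSpec A₂ a₂ b₂ c₂ ∧ HasSpec A₃ a₃ b₃ c₃ ∧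
      A₁ + A₂ + A₃ = 0 := by
  obtain h | h | h : (b₁ + a₂ + c₃ ≤ 0 ∧ 0 ≤ c₁ + b₂ + a₃) ∨
      (c₁ + b₂ + a₃ ≤ 0 ∧ 0 ≤ a₁ + c₂ + b₃) ∨ (a₁ + c₂ + b₃ ≤ 0 ∧ 0 ≤ b₁ + a₂ + c₃) := by
    have h0 : (b₁ + a₂ + c₃) + (c₁ + b₂ + a₃) + (a₁ + c₂ + b₃) = 0 := by linarith
    by_contra! H
    obtain ⟨H1, H2, H3⟩ := H
    rcases le_or_gt (b₁ + a₂ + c₃) 0 with h | h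
    · linarith [H1 h, H2 (H1 h).le]
    · rcases le_or_gt (a₁ + c₂ + b₃) 0 with h' | h'
      · linarith [H3 h']
      · linarith [H2 (by linarith)]
  · exact exists_triple_of_cyclic hs₁ hs₂ hs₃ hbab h.1 haac hcbb h.2 hcca
  · obtain ⟨A₂, A₃, A₁, h2, h3, h1, e⟩ := exists_triple_of_cyclic hs₂ hs₃ hs₁
      (by linarith) (by linarith) (by linarith) (by linarith) (by linarith) (by linarith)
    exact ⟨A₁, A₂, A₃, h1, h2, h3, by rw [← e]; abel⟩
  · obtain ⟨A₃, A₁, A₂, h3, h1, h2, e⟩ := exists_triple_of_cyclic hs₃ hs₁ hs₂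
      (by linarith) (by linarith) (by linarith) (by linarith) (by linarith) (by linarith)
    exact ⟨A₁, A₂, A₃, h1, h2, h3, by rw [← e]; abel⟩

/-- The Horn inequalities for the spectrum `(d₁, d₂, d₃)` of a sum of Hermitian matrices with
spectra `(a i, b i, c i)`, `i ∈ S`. -/
structure SumIneq {ι : Type*} (a b c : ι → ℝ) (S : Finset ι) (d₁ d₂ d₃ : ℝ) : Prop where
  fst_le : d₁ ≤ ∑ i ∈ S, a i
  snd_le : ∀ i ∈ S, d₂ ≤ ∑ i ∈ S, a i - (a i - b i)
  thd_le : ∀ i ∈ S, d₃ ≤ ∑ i ∈ S, a i - (a i - c i)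
  thd_le' : ∀ i ∈ S, ∀ j ∈ S, i ≠ j → d₃ ≤ ∑ i ∈ S, a i - (a i - b i) - (a j - b j)
  le_thd : ∑ i ∈ S, c i ≤ d₃
  le_snd : ∀ i ∈ S, ∑ i ∈ S, c i + (b i - c i) ≤ d₂
  le_fst : ∀ i ∈ S, ∑ i ∈ S, c i + (a i - c i) ≤ d₁
  le_fst' : ∀ i ∈ S, ∀ j ∈ S, i ≠ j → ∑ i ∈ S, c i + (b i - c i) + (b j - c j) ≤ d₁

/-- The Horn inequalities for a sum of two matrices. -/
structure PairIneq (p q r a b c d₁ d₂ d₃ : ℝ) : Prop where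
  le_pa : d₁ ≤ p + a
  le_pb : d₂ ≤ p + b
  le_qa : d₂ ≤ q + a
  le_pc : d₃ ≤ p + c
  le_qb : d₃ ≤ q + b
  le_ra : d₃ ≤ r + a
  rc_le : r + c ≤ d₃
  rb_le : r + b ≤ d₂
  qc_le : q + c ≤ d₂
  ra_le : r + a ≤ d₁
  qb_le : q + b ≤ d₁
  pc_le : p + c ≤ d₁

lemma PairIneq.exists_hasSpec {p q r a b c d₁ d₂ d₃ : ℝ} (h : PairIneq p q r a b c d₁ d₂ d₃)
    (hp : p + q + r = 0) (ha : a + b + c = 0) (hd : d₁ + d₂ + d₃ = 0) :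
    ∃ A B, HasSpec A p q r ∧ HasSpec B a b c ∧ HasSpec (A + B) d₁ d₂ d₃ := by
  obtain ⟨A, B, D, hA, hB, hD, e⟩ := exists_triple (a₃ := -d₃) (b₃ := -d₂) (c₃ := -d₁) hp ha
    (by linarith) (by linarith [h.le_pa]) (by linarith [h.pc_le, h.le_pc])
    (by linarith [h.le_ra]) (by linarith [h.le_qb]) (by linarith [h.le_qa])
    (by linarith [h.le_pb]) (by linarith [h.rc_le]) (by linarith [h.ra_le])
    (by linarith [h.pc_le]) (by linarith [h.qb_le]) (by linarith [h.qc_le])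
    (by linarith [h.rb_le])
  refine ⟨A, B, hA, hB, ?_⟩
  rw [eq_neg_of_add_eq_zero_left e]
  simpa using hD.neg

lemma exists_between_triples {l₁ l₂ l₃ u₁ u₂ u₃ : ℝ} (hl₁ : l₂ ≤ l₁) (hl₂ : l₃ ≤ l₂)
    (hu₁ : u₂ ≤ u₁) (hu₂ : u₃ ≤ u₂) (h₁ : l₁ ≤ u₁) (h₂ : l₂ ≤ u₂) (h₃ : l₃ ≤ u₃)
    (hl : l₁ + l₂ + l₃ ≤ 0) (hu : 0 ≤ u₁ + u₂ + u₃) :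
    ∃ x y z, x + y + z = 0 ∧ y ≤ x ∧ z ≤ y ∧
      l₁ ≤ x ∧ x ≤ u₁ ∧ l₂ ≤ y ∧ y ≤ u₂ ∧ l₃ ≤ z ∧ z ≤ u₃ := by
  obtain ⟨t, ⟨ht0, ht1⟩, ht⟩ : (0 : ℝ) ∈ (fun t : ℝ => (1 - t) * (l₁ + l₂ + l₃) +
      t * (u₁ + u₂ + u₃)) '' Set.Icc 0 1 :=
    intermediate_value_Icc zero_le_one (by fun_prop) ⟨by simpa using hl, by simpa using hu⟩
  have ht2 : 0 ≤ 1 - t := by linarith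
  refine ⟨(1 - t) * l₁ + t * u₁, (1 - t) * l₂ + t * u₂, (1 - t) * l₃ + t * u₃,
    by simp only at ht; linarith, by gcongr, by gcongr, ?_, ?_, ?_, ?_, ?_, ?_⟩ <;>
  nlinarith [mul_nonneg ht0 (sub_nonneg.2 h₁), mul_nonneg ht0 (sub_nonneg.2 h₂),
    mul_nonneg ht0 (sub_nonneg.2 h₃), mul_nonneg ht2 (sub_nonneg.2 h₁),
    mul_nonneg ht2 (sub_nonneg.2 h₂), mul_nonneg ht2 (sub_nonneg.2 h₃)]

lemma exists_nonneg_max {ι : Type*} (S : Finset ι) (f : ι → ℝ) :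
    ∃ M, 0 ≤ M ∧ (∀ i ∈ S, f i ≤ M) ∧ (M = 0 ∨ ∃ i ∈ S, M = f i) := by
  classical
  induction S using Finset.induction with
  | empty => exact ⟨0, le_rfl, by simp, .inl rfl⟩
  | insert i S _ ih =>
    obtain ⟨M, h0, h1, h2⟩ := ih
    rcases le_total (f i) M with h | h
    · exact ⟨M, h0, by simpa using ⟨h, h1⟩, h2.imp_right (by simp; grind)⟩
    · exact ⟨f i, h0.trans h, by simpa using fun j hj => (h1 j hj).trans h,
        .inr ⟨i, by simp, rfl⟩⟩

/-- The largest of `0`, the `x i + y i` and the `x i + x j` with `i ≠ j`. -/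
lemma exists_nonneg_max_pair {ι : Type*} (S : Finset ι) (x y : ι → ℝ) :
    ∃ M, 0 ≤ M ∧ (∀ i ∈ S, x i + y i ≤ M) ∧ (∀ i ∈ S, ∀ j ∈ S, i ≠ j → x i + x j ≤ M) ∧
      (M = 0 ∨ (∃ i ∈ S, M = x i + y i) ∨ ∃ i ∈ S, ∃ j ∈ S, i ≠ j ∧ M = x i + x j) := by
  classical
  obtain ⟨M, h0, h1, h2⟩ := exists_nonneg_max (S ×ˢ S)
    fun p => if p.1 = p.2 then x p.1 + y p.1 else x p.1 + x p.2
  refine ⟨M, h0, fun i hi => by simpa using h1 (i, i) (by simp [hi]), fun i hi j hj hij => by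
    simpa [hij] using h1 (i, j) (by simp [hi, hj]), h2.imp_right ?_⟩
  rintro ⟨⟨i, j⟩, hp, e⟩
  rw [mem_product] at hp
  by_cases hij : i = j
  · exact .inl ⟨i, hp.1, by simpa [hij] using e⟩
  · exact .inr ⟨i, hp.1, j, hp.2, hij, by simpa [hij] using e⟩

lemma add_le_sum_of_ne {ι : Type*} {S : Finset ι} {x : ι → ℝ} (hx : ∀ i ∈ S, 0 ≤ x i) {i j : ι}
    (hi : i ∈ S) (hj : j ∈ S) (hij : i ≠ j) : x i + x j ≤ ∑ k ∈ S, x k := by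
  classical
  rw [← sum_pair hij]
  exact sum_le_sum_of_subset_of_nonneg (by simp [insert_subset_iff, hi, hj])
    fun k hk _ => hx k hk

/-- The maximum of pair sums of `x` against the one of `y`. -/
lemma max_pair_le {ι : Type*} {S : Finset ι} {x y : ι → ℝ} (hx : ∀ i ∈ S, 0 ≤ x i)
    (hy : ∀ i ∈ S, 0 ≤ y i) {M₂ M₃ N₂ N₃ : ℝ}
    (hM₂ : M₂ = 0 ∨ ∃ i ∈ S, M₂ = x i)
    (hM₃ : M₃ = 0 ∨ (∃ i ∈ S, M₃ = x i + y i) ∨ ∃ i ∈ S, ∃ j ∈ S, i ≠ j ∧ M₃ = x i + x j)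
    (hN₂ : ∀ i ∈ S, y i ≤ N₂) (hN₂0 : 0 ≤ N₂) (hN₃ : ∀ i ∈ S, y i + x i ≤ N₃) (hN₃0 : 0 ≤ N₃) :
    M₂ ≤ ∑ i ∈ S, x i ∧ M₃ ≤ ∑ i ∈ S, x i + N₂ ∧ M₃ ≤ ∑ i ∈ S, x i + ∑ i ∈ S, y i ∧
      M₂ + M₃ ≤ ∑ i ∈ S, x i + N₃ := by
  have px : 0 ≤ ∑ i ∈ S, x i := sum_nonneg hx
  have py : 0 ≤ ∑ i ∈ S, y i := sum_nonneg hy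
  have sx := fun i hi => single_le_sum hx (a := i) hi
  have sy := fun i hi => single_le_sum hy (a := i) hi
  have sxx := fun i hi j hj hij => add_le_sum_of_ne hx (i := i) (j := j) hi hj hij
  rcases hM₂ with rfl | ⟨k, hk, rfl⟩ <;>
  rcases hM₃ with rfl | ⟨i, hi, rfl⟩ | ⟨i, hi, j, hj, hij, rfl⟩
  · exact ⟨by linarith, by linarith, by linarith, by linarith⟩
  · have := sx i hi
    have := sy i hi
    have := hN₂ i hi
    have := hN₃ i hi
    exact ⟨by linarith, by linarith, by linarith, by linarith⟩
  · have := sxx i hi j hj hij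
    exact ⟨by linarith, by linarith, by linarith, by linarith⟩
  · have := sx k hk
    exact ⟨by linarith, by linarith, by linarith, by linarith⟩
  · have := sx i hi
    have := sx k hk
    have := sy i hi
    have := hN₂ i hi
    have := hN₃ i hi
    have := hx i hi
    have := hy i hi
    refine ⟨by linarith, by linarith, by linarith, ?_⟩
    by_cases hki : k = i
    · subst hki
      linarith
    · have := sxx k hk i hi hki
      linarith
  · have := sx k hk
    have := sxx i hi j hj hij
    have := hN₃ k hk
    have := hy k hk
    exact ⟨by linarith, by linarith, by linarith, by linarith⟩

lemma max_max_eq (x y z : ℝ) : max x (max y z) = x ∨ max x (max y z) = y ∨ max x (max y z) = z :=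
  by
  rcases max_choice x (max y z) with h | h <;> rw [h]
  exacts [.inl rfl, .inr (max_choice y z)]

lemma min_min_eq (x y z : ℝ) : min x (min y z) = x ∨ min x (min y z) = y ∨ min x (min y z) = z :=
  by
  rcases min_choice x (min y z) with h | h <;> rw [h]
  exacts [.inl rfl, .inr (min_choice y z)]

/-- The linear-programming step: the constraints of `PairIneq` are compatible with boxes for
`p`, `q`, `r` of the shape produced by `SumIneq`. -/
lemma exists_pairIneq {A B C M₂ M₃ N₂ N₃ α β γ d₁ d₂ d₃ : ℝ} (hS : A + B + C = 0)
    (hM₂ : 0 ≤ M₂) (hN₂ : 0 ≤ N₂) (hM : M₂ ≤ M₃) (hN : N₂ ≤ N₃)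
    (e1 : M₂ ≤ A - B) (e2 : M₃ ≤ A - B + N₂) (e3 : M₃ ≤ A - B + (B - C))
    (e4 : M₂ + M₃ ≤ A - B + N₃)
    (f1 : N₂ ≤ B - C) (f2 : N₃ ≤ B - C + M₂)
    (f4 : N₂ + N₃ ≤ B - C + M₃)
    (hα : α + β + γ = 0) (hαβ : β ≤ α) (hβγ : γ ≤ β)
    (hd : d₁ + d₂ + d₃ = 0) (hd₁ : d₂ ≤ d₁) (hd₂ : d₃ ≤ d₂)
    (u1 : d₁ - α ≤ A) (u2 : d₂ - β ≤ A) (u3 : d₃ - γ ≤ A)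
    (u4 : d₂ - α ≤ A - M₂) (u5 : d₃ - β ≤ A - M₂) (u6 : d₃ - α ≤ A - M₃)
    (l1 : C ≤ d₃ - γ) (l2 : C ≤ d₂ - β) (l3 : C ≤ d₁ - α)
    (l4 : C + N₂ ≤ d₂ - γ) (l5 : C + N₂ ≤ d₁ - β) (l6 : C + N₃ ≤ d₁ - γ) :
    ∃ p q r, p + q + r = 0 ∧ q ≤ p ∧ r ≤ q ∧ C + N₃ ≤ p ∧ p ≤ A ∧ C + N₂ ≤ q ∧ q ≤ A - M₂ ∧
      C ≤ r ∧ r ≤ A - M₃ ∧ PairIneq p q r α β γ d₁ d₂ d₃ := by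
  obtain ⟨p, q, r, hs, hpq, hqr, hp, hp', hq, hq', hr, hr'⟩ := exists_between_triples
    (l₁ := max (max (C + N₃) (d₁ - α)) (max (d₂ - β) (d₃ - γ)))
    (l₂ := max (C + N₂) (max (d₂ - α) (d₃ - β)))
    (l₃ := max C (d₃ - α))
    (u₁ := min A (d₁ - γ))
    (u₂ := min (A - M₂) (min (d₂ - γ) (d₁ - β)))
    (u₃ := min (min (A - M₃) (d₃ - γ)) (min (d₂ - β) (d₁ - α)))
    (max_le (le_max_of_le_left (le_max_of_le_left (by linarith)))
      (max_le (le_max_of_le_left (le_max_of_le_right (by linarith)))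
        (le_max_of_le_right (le_max_of_le_left (by linarith)))))
    (max_le (le_max_of_le_left (by linarith))
      (le_max_of_le_right (le_max_of_le_left (by linarith))))
    (le_min (min_le_of_left_le (by linarith))
      (min_le_of_right_le (min_le_of_right_le (by linarith))))
    (le_min (min_le_of_left_le (min_le_of_left_le (by linarith)))
      (le_min (min_le_of_right_le (min_le_of_left_le (by linarith)))
        (min_le_of_right_le (min_le_of_right_le (by linarith)))))
    (by simp only [le_min_iff, max_le_iff]; refine ⟨⟨⟨?_, ?_⟩, ?_, ?_⟩, ⟨?_, ?_⟩, ?_, ?_⟩ <;>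
      linarith)
    (by simp only [le_min_iff, max_le_iff]; refine ⟨⟨?_, ?_, ?_⟩, ⟨?_, ?_, ?_⟩, ?_, ?_, ?_⟩ <;>
      linarith)
    (by
      simp only [le_min_iff, max_le_iff]
      refine ⟨⟨⟨?_, ?_⟩, ?_, ?_⟩, ⟨?_, ?_⟩, ?_, ?_⟩ <;> linarith)
    (by
      rcases max_choice (max (C + N₃) (d₁ - α)) (max (d₂ - β) (d₃ - γ)) with h₁ | h₁ <;>
      rw [h₁] <;>
      [rcases max_choice (C + N₃) (d₁ - α) with h₁' | h₁';
        rcases max_choice (d₂ - β) (d₃ - γ) with h₁' | h₁'] <;> rw [h₁'] <;>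
      rcases max_choice C (d₃ - α) with h₃ | h₃ <;> rw [h₃] <;>
      rcases max_max_eq (C + N₂) (d₂ - α) (d₃ - β) with h₂ | h₂ | h₂ <;> rw [h₂] <;> linarith)
    (by
      rcases min_choice (min (A - M₃) (d₃ - γ)) (min (d₂ - β) (d₁ - α)) with h₁ | h₁ <;>
      rw [h₁] <;>
      [rcases min_choice (A - M₃) (d₃ - γ) with h₁' | h₁';
        rcases min_choice (d₂ - β) (d₁ - α) with h₁' | h₁'] <;> rw [h₁'] <;>
      rcases min_choice A (d₁ - γ) with h₃ | h₃ <;> rw [h₃] <;>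
      rcases min_min_eq (A - M₂) (d₂ - γ) (d₁ - β) with h₂ | h₂ | h₂ <;> rw [h₂] <;> linarith)
  simp only [le_min_iff, max_le_iff] at hp hp' hq hq' hr hr'
  exact ⟨p, q, r, hs, hpq, hqr, hp.1.1, hp'.1, hq.1, hq'.1, hr.1, hr'.1.1, by
    constructor <;> linarith⟩

lemma SumIneq.exists_split {ι : Type*} [DecidableEq ι] {a b c : ι → ℝ}
    (hab : ∀ i, b i ≤ a i) (hbc : ∀ i, c i ≤ b i) (hsum : ∀ i, a i + b i + c i = 0)
    {S : Finset ι} {m : ι} (hm : m ∉ S) {d₁ d₂ d₃ : ℝ} (hd : d₁ + d₂ + d₃ = 0)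
    (hd₁ : d₂ ≤ d₁) (hd₂ : d₃ ≤ d₂) (h : SumIneq a b c (insert m S) d₁ d₂ d₃) :
    ∃ p q r, p + q + r = 0 ∧ q ≤ p ∧ r ≤ q ∧ SumIneq a b c S p q r ∧
      PairIneq p q r (a m) (b m) (c m) d₁ d₂ d₃ := by
  have hx : ∀ i ∈ S, 0 ≤ a i - b i := fun i _ => sub_nonneg.2 (hab i)
  have hy : ∀ i ∈ S, 0 ≤ b i - c i := fun i _ => sub_nonneg.2 (hbc i)
  obtain ⟨M₂, hM₂0, hM₂, hM₂'⟩ := exists_nonneg_max S fun i => a i - b i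
  obtain ⟨N₂, hN₂0, hN₂, hN₂'⟩ := exists_nonneg_max S fun i => b i - c i
  obtain ⟨M₃, hM₃0, hM₃, hM₃2, hM₃'⟩ :=
    exists_nonneg_max_pair S (fun i => a i - b i) fun i => b i - c i
  obtain ⟨N₃, hN₃0, hN₃, hN₃2, hN₃'⟩ :=
    exists_nonneg_max_pair S (fun i => b i - c i) fun i => a i - b i
  obtain ⟨e1, e2, e3, e4⟩ := max_pair_le hx hy hM₂' hM₃' hN₂ hN₂0 hN₃ hN₃0
  obtain ⟨f1, f2, -, f4⟩ := max_pair_le hy hx hN₂' hN₃' hM₂ hM₂0 hM₃ hM₃0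
  have hM : M₂ ≤ M₃ := by
    rcases hM₂' with rfl | ⟨i, hi, rfl⟩
    · exact hM₃0
    · linarith [hM₃ i hi, hy i hi]
  have hN : N₂ ≤ N₃ := by
    rcases hN₂' with rfl | ⟨i, hi, rfl⟩
    · exact hN₃0
    · linarith [hN₃ i hi, hx i hi]
  have hS : ∑ i ∈ S, a i + ∑ i ∈ S, b i + ∑ i ∈ S, c i = 0 := by
    rw [← sum_add_distrib, ← sum_add_distrib]
    exact sum_eq_zero fun i _ => hsum i
  rw [sum_sub_distrib] at e1 e2 e4 f1 f2 f4
  rw [sum_sub_distrib, sum_sub_distrib] at e3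
  have hdis : ∀ i ∈ S, m ≠ i := fun i hi e => hm (e ▸ hi)
  obtain ⟨g1, g2, g3, g4, k1, k2, k3, k4⟩ := h
  simp only [forall_mem_insert, sum_insert hm] at g1 g2 g3 g4 k1 k2 k3 k4
  have hsm := hsum m
  have habm := hab m
  have hbcm := hbc m
  set A := ∑ i ∈ S, a i
  set B := ∑ i ∈ S, b i
  set C := ∑ i ∈ S, c i
  have u1 : d₁ - a m ≤ A := by linarith
  have u2 : d₂ - b m ≤ A := by linarith [g2.1]
  have u3 : d₃ - c m ≤ A := by linarith [g3.1]
  have u4 : d₂ - a m ≤ A - M₂ := by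
    rcases hM₂' with rfl | ⟨i, hi, rfl⟩
    · linarith
    · linarith [g2.2 i hi]
  have u5 : d₃ - b m ≤ A - M₂ := by
    rcases hM₂' with rfl | ⟨i, hi, rfl⟩
    · linarith [g2.1]
    · linarith [g4.1.2 i hi (hdis i hi)]
  have u6 : d₃ - a m ≤ A - M₃ := by
    rcases hM₃' with rfl | ⟨i, hi, rfl⟩ | ⟨i, hi, j, hj, hij, rfl⟩
    · linarith
    · linarith [g3.2 i hi]
    · linarith [(g4.2 i hi).2 j hj hij]
  have l1 : C ≤ d₃ - c m := by linarith
  have l2 : C ≤ d₂ - b m := by linarith [k2.1]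
  have l3 : C ≤ d₁ - a m := by linarith [k3.1]
  have l4 : C + N₂ ≤ d₂ - c m := by
    rcases hN₂' with rfl | ⟨i, hi, rfl⟩
    · linarith
    · linarith [k2.2 i hi]
  have l5 : C + N₂ ≤ d₁ - b m := by
    rcases hN₂' with rfl | ⟨i, hi, rfl⟩
    · linarith [k2.1]
    · linarith [k4.1.2 i hi (hdis i hi)]
  have l6 : C + N₃ ≤ d₁ - c m := by
    rcases hN₃' with rfl | ⟨i, hi, rfl⟩ | ⟨i, hi, j, hj, hij, rfl⟩
    · linarith
    · linarith [k3.2 i hi]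
    · linarith [(k4.2 i hi).2 j hj hij]
  obtain ⟨p, q, r, hs, hpq, hqr, hp, hp', hq, hq', hr, hr', hP⟩ := exists_pairIneq hS hM₂0 hN₂0
    hM hN e1 e2 e3 e4 f1 f2 f4 hsm habm hbcm hd hd₁ hd₂ u1 u2 u3 u4 u5 u6 l1 l2 l3 l4 l5 l6
  refine ⟨p, q, r, hs, hpq, hqr, ⟨?_, ?_, ?_, ?_, ?_, ?_, ?_, ?_⟩, hP⟩
  · exact hp'
  · exact fun i hi => by linarith [hM₂ i hi]
  · exact fun i hi => by linarith [hM₃ i hi]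
  · exact fun i hi j hj hij => by linarith [hM₃2 i hi j hj hij]
  · exact hr
  · exact fun i hi => by linarith [hN₂ i hi]
  · exact fun i hi => by linarith [hN₃ i hi]
  · exact fun i hi j hj hij => by linarith [hN₃2 i hi j hj hij]

lemma exists_perm_comp_eq_of_map_eq {α β : Type*} [Fintype α] [DecidableEq β] {f g : α → β}
    (h : (univ : Finset α).val.map f = (univ : Finset α).val.map g) :
    ∃ σ : Equiv.Perm α, ∀ x, g (σ x) = f x := by
  have hc : ∀ y, Nonempty ({x // f x = y} ≃ {x // g x = y}) := fun y => by
    have := congrArg (Multiset.count y) h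
    rw [Multiset.count_map, Multiset.count_map] at this
    refine ⟨Fintype.equivOfCardEq ?_⟩
    rw [Fintype.card_subtype, Fintype.card_subtype, card_def, card_def, filter_val, filter_val]
    simpa only [eq_comm] using this
  exact ⟨Equiv.ofFiberEquiv fun y => (hc y).some, Equiv.ofFiberEquiv_map _⟩

lemma HasSpec.charpoly_eq {A : Matrix (Fin 3) (Fin 3) ℂ} {a b c : ℝ} (h : HasSpec A a b c) :
    A.charpoly = (Polynomial.X - Polynomial.C (a : ℂ)) * (Polynomial.X - Polynomial.C (b : ℂ)) *
      (Polynomial.X - Polynomial.C (c : ℂ)) :=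
  Polynomial.funext fun z => by simpa [eval_charpoly] using h.2 z

lemma hasSpec_iff {A : Matrix (Fin 3) (Fin 3) ℂ} {a b c : ℝ} :
    HasSpec A a b c ↔ ∃ h : A.IsHermitian, ∃ σ : Equiv.Perm (Fin 3),
      ∀ j, h.eigenvalues (σ j) = ![a, b, c] j := by
  constructor
  · intro h
    have h1 := h.1.roots_charpoly_eq_eigenvalues
    have h2 : A.charpoly = ((univ.val.map fun i => ((![a, b, c] i : ℝ) : ℂ)).map
        fun x => Polynomial.X - Polynomial.C x).prod := by
      rw [h.charpoly_eq, Multiset.map_map]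
      exact (Fin.prod_univ_three fun i : Fin 3 =>
        Polynomial.X - Polynomial.C ((![a, b, c] i : ℝ) : ℂ)).symm
    rw [h2, Polynomial.roots_multiset_prod_X_sub_C] at h1
    obtain ⟨σ, hσ⟩ := exists_perm_comp_eq_of_map_eq h1
    exact ⟨h.1, σ, fun j => Complex.ofReal_injective (hσ j)⟩
  · rintro ⟨h, σ, hσ⟩
    refine ⟨h, fun z => ?_⟩
    have h1 := congrArg (Polynomial.eval z) h.charpoly_eq
    rw [eval_charpoly, ← Equiv.prod_comp σ] at h1
    simpa [Fin.prod_univ_three, hσ] using h1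

lemma HasSpec.unitary_conj {A : Matrix (Fin 3) (Fin 3) ℂ} {a b c : ℝ} (h : HasSpec A a b c)
    {U : Matrix (Fin 3) (Fin 3) ℂ} (hU : U ∈ unitaryGroup (Fin 3) ℂ) :
    HasSpec (U * A * star U) a b c := by
  refine ⟨isHermitian_mul_mul_conjTranspose U h.1, fun z => ?_⟩
  have e : scalar (Fin 3) z - U * A * star U = U * (scalar (Fin 3) z - A) * star U := by
    rw [mul_sub, sub_mul, (scalar_commute z (Commute.all z) U).symm.eq,
      mul_assoc (scalar (Fin 3) z), mem_unitaryGroup_iff.1 hU, mul_one]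
  rw [e, det_mul_right_comm, mem_unitaryGroup_iff.1 hU, one_mul, h.2]

lemma HasSpec.exists_unitary_conj {A B : Matrix (Fin 3) (Fin 3) ℂ} {a b c : ℝ}
    (hA : HasSpec A a b c) (hB : HasSpec B a b c) :
    ∃ U ∈ unitaryGroup (Fin 3) ℂ, B = U * A * star U := by
  have e := (hA.1.eigenvalues_eq_eigenvalues_iff hB.1).2 (hA.charpoly_eq.trans hB.charpoly_eq.symm)
  have h1 := hA.1.spectral_theorem
  have h2 := hB.1.spectral_theorem
  rw [← e] at h2
  rw [Unitary.conjStarAlgAut_apply] at h1 h2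
  set P := hA.1.eigenvectorUnitary
  set Q := hB.1.eigenvectorUnitary
  refine ⟨_, (Q * star P).2, ?_⟩
  generalize diagonal ((RCLike.ofReal : ℝ → ℂ) ∘ hA.1.eigenvalues) = D at h1 h2
  rw [h1, h2]
  have hP : star (P : Matrix (Fin 3) (Fin 3) ℂ) * P = 1 := Unitary.coe_star_mul_self P
  simp only [Submonoid.coe_mul, Unitary.coe_star, star_mul, star_star]
  calc (Q : Matrix (Fin 3) (Fin 3) ℂ) * D * star (Q : Matrix (Fin 3) (Fin 3) ℂ)
      = Q * (star (P : Matrix (Fin 3) (Fin 3) ℂ) * P) * D *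
        (star (P : Matrix (Fin 3) (Fin 3) ℂ) * P) * star (Q : Matrix (Fin 3) (Fin 3) ℂ) := by
        rw [hP, mul_one, mul_one]
    _ = _ := by simp only [mul_assoc]

lemma hasSpec_zero : HasSpec 0 0 0 0 :=
  ⟨isHermitian_zero, fun z => by simp [pow_succ]⟩

lemma HasSpec.eq_zero {A : Matrix (Fin 3) (Fin 3) ℂ} (h : HasSpec A 0 0 0) : A = 0 := by
  obtain ⟨U, -, e⟩ := hasSpec_zero.exists_unitary_conj h
  simpa using e

lemma exists_hasSpec_of_sumIneq {ι : Type*} [DecidableEq ι] {a b c : ι → ℝ}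
    (hab : ∀ i, b i ≤ a i) (hbc : ∀ i, c i ≤ b i) (hsum : ∀ i, a i + b i + c i = 0)
    (S : Finset ι) {d₁ d₂ d₃ : ℝ} (hd : d₁ + d₂ + d₃ = 0) (hd₁ : d₂ ≤ d₁) (hd₂ : d₃ ≤ d₂)
    (h : SumIneq a b c S d₁ d₂ d₃) :
    ∃ A : ι → Matrix (Fin 3) (Fin 3) ℂ, (∀ i ∈ S, HasSpec (A i) (a i) (b i) (c i)) ∧
      HasSpec (∑ i ∈ S, A i) d₁ d₂ d₃ := by
  induction S using Finset.induction generalizing d₁ d₂ d₃ with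
  | empty =>
    have h1 := h.fst_le
    have h3 := h.le_thd
    rw [sum_empty] at h1 h3
    obtain rfl : d₁ = 0 := by linarith
    obtain rfl : d₂ = 0 := by linarith
    obtain rfl : d₃ = 0 := by linarith
    exact ⟨0, by simp, by simpa using hasSpec_zero⟩
  | insert m S hm ih =>
    obtain ⟨p, q, r, hs, hpq, hqr, hS, hP⟩ := h.exists_split hab hbc hsum hm hd hd₁ hd₂
    obtain ⟨A, hA, hAS⟩ := ih hs hpq hqr hS
    obtain ⟨X, Y, hX, hY, hXY⟩ := hP.exists_hasSpec hs (hsum m) hd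
    obtain ⟨U, hU, e⟩ := hX.exists_unitary_conj hAS
    refine ⟨Function.update A m (U * Y * star U), ?_, ?_⟩
    · rw [forall_mem_insert]
      refine ⟨by simpa using hY.unitary_conj hU, fun i hi => ?_⟩
      rw [Function.update_of_ne (ne_of_mem_of_not_mem hi hm)]
      exact hA i hi
    · rw [sum_insert hm, sum_update_of_notMem hm, Function.update_self, e, ← add_mul, ← mul_add,
        add_comm Y]
      exact hXY.unitary_conj hU

lemma hasSpec_diagonal (a b c : ℝ) : HasSpec (diagonal ![(a : ℂ), b, c]) a b c := by
  refine ⟨?_, fun z => ?_⟩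
  · ext i j
    fin_cases i <;> fin_cases j <;> simp [Complex.conj_ofReal]
  · simp [Fin.prod_univ_three]

/-- The quadratic form of a matrix with prescribed spectrum, in an orthonormal eigenbasis. -/
lemma HasSpec.exists_quadratic_form {A : Matrix (Fin 3) (Fin 3) ℂ} {a b c : ℝ}
    (h : HasSpec A a b c) : ∃ W : Matrix (Fin 3) (Fin 3) ℂ, ∀ v : Fin 3 → ℂ,
      (star v ⬝ᵥ A *ᵥ v).re = a * Complex.normSq ((W *ᵥ v) 0) +
        b * Complex.normSq ((W *ᵥ v) 1) + c * Complex.normSq ((W *ᵥ v) 2) ∧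
      Complex.normSq ((W *ᵥ v) 0) + Complex.normSq ((W *ᵥ v) 1) +
        Complex.normSq ((W *ᵥ v) 2) = ∑ k, Complex.normSq (v k) := by
  obtain ⟨U, hU, rfl⟩ := (hasSpec_diagonal a b c).exists_unitary_conj h
  have key : ∀ (D : Matrix (Fin 3) (Fin 3) ℂ) (v : Fin 3 → ℂ),
      star v ⬝ᵥ (U * D * star U) *ᵥ v = star (star U *ᵥ v) ⬝ᵥ D *ᵥ (star U *ᵥ v) := by
    intro D v
    rw [star_mulVec, star_eq_conjTranspose, conjTranspose_conjTranspose, ← dotProduct_mulVec,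
      mulVec_mulVec, mulVec_mulVec, mul_assoc]
  refine ⟨star U, fun v => ⟨?_, ?_⟩⟩
  · rw [key]
    generalize star U *ᵥ v = w
    simp [dotProduct, Fin.sum_univ_three, mulVec_diagonal, Complex.normSq_apply]
    ring
  · have := congrArg Complex.re (key 1 v)
    rw [mul_one, mem_unitaryGroup_iff.1 hU, one_mulVec, one_mulVec] at this
    simpa [dotProduct, Fin.sum_univ_three, Complex.normSq_apply] using this.symm

lemma exists_ne_zero_dotProduct_eq_zero_and (φ ψ : Fin 3 → ℂ) :
    ∃ v ≠ 0, φ ⬝ᵥ v = 0 ∧ ψ ⬝ᵥ v = 0 := by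
  obtain ⟨v, hv, h⟩ := exists_mulVec_eq_zero_iff (M := of ![φ, ψ, 0]) |>.2 <|
    det_eq_zero_of_row_eq_zero 2 fun _ => rfl
  exact ⟨v, hv, congrFun h 0, congrFun h 1⟩

/-- A lower bound at a common vector for the quadratic forms of matrices summing to zero. -/
lemma sum_nonpos_of_forall_le_quadratic_form {ι : Type*} [Fintype ι]
    {A : ι → Matrix (Fin 3) (Fin 3) ℂ} (hA : ∑ i, A i = 0) {e : ι → ℝ} {v : Fin 3 → ℂ}
    (hv : v ≠ 0) (he : ∀ i, e i * ∑ k, Complex.normSq (v k) ≤ (star v ⬝ᵥ A i *ᵥ v).re) :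
    ∑ i, e i ≤ 0 := by
  have hpos : 0 < ∑ k, Complex.normSq (v k) := by
    obtain ⟨k, hk⟩ := Function.ne_iff.1 hv
    exact sum_pos' (fun _ _ => Complex.normSq_nonneg _) ⟨k, mem_univ k, Complex.normSq_pos.2 hk⟩
  have h0 : ∑ i, (star v ⬝ᵥ A i *ᵥ v).re = 0 := by
    rw [← Complex.re_sum, ← dotProduct_sum, ← sum_mulVec, hA]
    simp
  have := sum_le_sum fun i (_ : i ∈ univ) => he i
  rw [h0, ← sum_mul] at this
  exact nonpos_of_mul_nonpos_left this hpos

lemma add_sum_erase_nonpos {ι : Type*} [Fintype ι] [DecidableEq ι] {a b c : ι → ℝ}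
    (hab : ∀ i, b i ≤ a i) (hbc : ∀ i, c i ≤ b i) {A : ι → Matrix (Fin 3) (Fin 3) ℂ}
    (hA : ∑ i, A i = 0) (hs : ∀ i, HasSpec (A i) (a i) (b i) (c i)) :
    (∀ i, a i + ∑ j ∈ univ.erase i, c j ≤ 0) ∧
      ∀ i j, i ≠ j → b i + b j + ∑ k ∈ (univ.erase i).erase j, c k ≤ 0 := by
  choose W hW using fun i => (hs i).exists_quadratic_form
  have hc : ∀ i v, c i * ∑ k, Complex.normSq (v k) ≤ (star v ⬝ᵥ A i *ᵥ v).re := by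
    intro i v
    rw [(hW i v).1, ← (hW i v).2]
    nlinarith [Complex.normSq_nonneg ((W i *ᵥ v) 0), Complex.normSq_nonneg ((W i *ᵥ v) 1),
      hab i, hbc i]
  have hb : ∀ i v, (W i *ᵥ v) 2 = 0 →
      b i * ∑ k, Complex.normSq (v k) ≤ (star v ⬝ᵥ A i *ᵥ v).re := by
    intro i v h
    rw [(hW i v).1, ← (hW i v).2, h, map_zero]
    nlinarith [Complex.normSq_nonneg ((W i *ᵥ v) 0), hab i]
  refine ⟨fun i => ?_, fun i j hij => ?_⟩
  · obtain ⟨v, hv, h1, h2⟩ := exists_ne_zero_dotProduct_eq_zero_and (W i 1) (W i 2)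
    have := sum_nonpos_of_forall_le_quadratic_form hA (e := Function.update c i (a i)) hv
      fun j => ?_
    · rwa [sum_update_of_mem (mem_univ i), sdiff_singleton_eq_erase] at this
    · rcases eq_or_ne j i with rfl | hj
      · have e1 : (W j *ᵥ v) 1 = 0 := h1
        have e2 : (W j *ᵥ v) 2 = 0 := h2
        rw [Function.update_self, (hW j v).1, ← (hW j v).2, e1, e2]
        simp
      · rw [Function.update_of_ne hj]
        exact hc j v
  · obtain ⟨v, hv, h1, h2⟩ := exists_ne_zero_dotProduct_eq_zero_and (W i 2) (W j 2)
    have := sum_nonpos_of_forall_le_quadratic_form hA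
      (e := Function.update (Function.update c j (b j)) i (b i)) hv fun k => ?_
    · rwa [sum_update_of_mem (mem_univ i), sdiff_singleton_eq_erase,
        sum_update_of_mem (by simp [hij.symm]), sdiff_singleton_eq_erase, ← add_assoc] at this
    · rcases eq_or_ne k i with rfl | hi
      · rw [Function.update_self]
        exact hb k v h1
      rw [Function.update_of_ne hi]
      rcases eq_or_ne k j with rfl | hj
      · rw [Function.update_self]
        exact hb k v h2
      · rw [Function.update_of_ne hj]
        exact hc k v

lemma SumIneq.of_stability {ι : Type*} [Fintype ι] [Nonempty ι] [DecidableEq ι] {a b c : ι → ℝ}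
    (hab : ∀ i, b i ≤ a i) (hbc : ∀ i, c i ≤ b i)
    (h1 : ∀ i, a i + ∑ j ∈ univ.erase i, c j ≤ 0)
    (h2 : ∀ i j, i ≠ j → b i + b j + ∑ k ∈ (univ.erase i).erase j, c k ≤ 0)
    (h3 : ∀ i, 0 ≤ c i + ∑ j ∈ univ.erase i, a j)
    (h4 : ∀ i j, i ≠ j → 0 ≤ b i + b j + ∑ k ∈ (univ.erase i).erase j, a k) :
    SumIneq a b c univ 0 0 0 := by
  have e : ∀ (f : ι → ℝ) i, ∑ j ∈ univ.erase i, f j = ∑ j, f j - f i := fun f i =>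
    eq_sub_of_add_eq' (add_sum_erase _ f (mem_univ i))
  have e' : ∀ (f : ι → ℝ) i j, i ≠ j →
      ∑ k ∈ (univ.erase i).erase j, f k = ∑ j, f j - f i - f j := fun f i j hij => by
    rw [← e]
    exact eq_sub_of_add_eq' (add_sum_erase _ f (mem_erase.2 ⟨hij.symm, mem_univ j⟩))
  obtain ⟨i₀⟩ := ‹Nonempty ι›
  constructor
  · linarith [h3 i₀, e a i₀, hab i₀, hbc i₀]
  · exact fun i _ => by linarith [h3 i, e a i, hab i, hbc i]
  · exact fun i _ => by linarith [h3 i, e a i]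
  · exact fun i _ j _ hij => by linarith [h4 i j hij, e' a i j hij]
  · linarith [h1 i₀, e c i₀, hab i₀, hbc i₀]
  · exact fun i _ => by linarith [h1 i, e c i, hab i, hbc i]
  · exact fun i _ => by linarith [h1 i, e c i]
  · exact fun i _ j _ hij => by linarith [h2 i j hij, e' c i j hij]

/-- Eigenvalues-of-a-sum problem for traceless Hermitian `3×3` matrices
(root system `A₂`), arbitrary number of summands: the prescribed decreasing
trace-free spectra `(aᵢ, bᵢ, cᵢ)` are realized by traceless Hermitian matrices
`A₁, …, Aₙ` with `A₁ + … + Aₙ = 0` iff the stability inequalities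
(I)-(IV) hold. -/
theorem eigenvalues_of_sum_A2
    (n : ℕ) (hn : 3 ≤ n) (a b c : Fin n → ℝ)
    (hab : ∀ i, b i ≤ a i) (hbc : ∀ i, c i ≤ b i)
    (hsum : ∀ i, a i + b i + c i = 0) :
    (∃ A : Fin n → Matrix (Fin 3) (Fin 3) ℂ,
        (∑ i, A i) = 0 ∧
        ∀ i, ∃ h : (A i).IsHermitian,
          (A i).trace = 0 ∧
          ∃ σ : Equiv.Perm (Fin 3), ∀ j, h.eigenvalues (σ j) = ![a i, b i, c i] j) ↔
    ((∀ i, a i + ∑ j ∈ univ.erase i, c j ≤ 0) ∧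
     (∀ i j, i ≠ j → b i + b j + ∑ k ∈ (univ.erase i).erase j, c k ≤ 0) ∧
     (∀ i, 0 ≤ c i + ∑ j ∈ univ.erase i, a j) ∧
     (∀ i j, i ≠ j → 0 ≤ b i + b j + ∑ k ∈ (univ.erase i).erase j, a k)) := by
  constructor
  · rintro ⟨A, hA, h⟩
    have hs : ∀ i, HasSpec (A i) (a i) (b i) (c i) := fun i => by
      obtain ⟨h, -, hσ⟩ := h i
      exact hasSpec_iff.2 ⟨h, hσ⟩
    obtain ⟨h1, h2⟩ := add_sum_erase_nonpos hab hbc hA hs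
    obtain ⟨h3, h4⟩ := add_sum_erase_nonpos (A := fun i => -A i) (fun i => neg_le_neg (hbc i))
      (fun i => neg_le_neg (hab i)) (by rw [sum_neg_distrib, hA, neg_zero]) fun i => (hs i).neg
    refine ⟨h1, h2, fun i => ?_, fun i j hij => ?_⟩
    · have := h3 i
      rw [sum_neg_distrib] at this
      linarith
    · have := h4 i j hij
      rw [sum_neg_distrib] at this
      linarith
  · rintro ⟨h1, h2, h3, h4⟩
    have : Nonempty (Fin n) := ⟨⟨0, by omega⟩⟩
    obtain ⟨A, hA, h0⟩ := exists_hasSpec_of_sumIneq hab hbc hsum univ (by simp) le_rfl le_rfl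
      (SumIneq.of_stability hab hbc h1 h2 h3 h4)
    refine ⟨A, h0.eq_zero, fun i => ?_⟩
    obtain ⟨h, σ, hσ⟩ := hasSpec_iff.1 (hA i (mem_univ i))
    refine ⟨h, ?_, σ, hσ⟩
    rw [h.trace_eq_sum_eigenvalues, ← Equiv.sum_comp σ]
    simpa [hσ, Fin.sum_univ_three] using congrArg (RCLike.ofReal : ℝ → ℂ) (hsum i)
end
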